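/- arXiv:1311.3297 — 2 statements merged into one kernel-verified Lean document; each statement's English description precedes it below -/
import Mathlib

section
/- Let G be an e₁-gate graph with R diagram elements and let N ≥ 1. A state Γ ∈ Z_N(G) satisfies H(G,N)Γ = 0 (i.e., Γ is an N-particle frustration-free state for G) if and only if both of the following hold: (i) (A(G) − e₁·1)^{(w)} Γ = 0 for every w ∈ {1,…,N}, and (ii) Γ ∈ I(G,N). -/
open scoped Matrix

namespace GG

/-- `ω = e^{iπ/4}`. -/
noncomputable def omega : ℂ := Complex.exp (Real.pi * Complex.I / 4)

/-- The cyclic shift on `ℂ⁸`: `S|j⟩ = |j+1 mod 8⟩`, i.e. `⟨i|S|j⟩ = [i = j+1]`. -/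
noncomputable def S8 : Matrix (Fin 8) (Fin 8) ℂ :=
  Matrix.of fun i j => if i = j + 1 then 1 else 0

/-- `|ω⟩ = (1/√8) Σ_{j=0}^{7} ω^{−j} |j⟩`. -/
noncomputable def omegaVec : Fin 8 → ℂ :=
  fun j => ((1 : ℝ) / Real.sqrt 8 : ℝ) * omega ^ (-(j : ℤ))

/-- The Hadamard gate `H = (1/√2)[[1,1],[1,−1]]`. -/
noncomputable def Hmat : Matrix (Fin 2) (Fin 2) ℂ :=
  ((1 : ℝ) / Real.sqrt 2 : ℝ) • (!![1, 1; 1, -1] : Matrix (Fin 2) (Fin 2) ℂ)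

/-- The gate `T = diag(1, ω)`. -/
noncomputable def Tmat : Matrix (Fin 2) (Fin 2) ℂ := !![1, 0; 0, omega]

/-- The gates `U₁,…,U₈` of the circuit `C₀` (0-indexed):
`U₁ = U₂ = U₇ = U₈ = H`, `U₃ = U₅ = HT`, `U₄ = U₆ = (HT)†`. -/
noncomputable def gate : Fin 8 → Matrix (Fin 2) (Fin 2) ℂ :=
  ![Hmat, Hmat, Hmat * Tmat, (Hmat * Tmat)ᴴ, Hmat * Tmat, (Hmat * Tmat)ᴴ, Hmat, Hmat]

/-- For a matrix `W` all of whose entries are `0` or integer powers of `ω`, the operator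
`B(W)` obtained by replacing each entry `ω^k` by `S^k` (and each zero entry by the zero
block): since `(S^k)_{ij} = [i−j ≡ k (mod 8)]` and the powers `ω^0,…,ω^7` are distinct,
this is implemented by `B(W)_{(a,i),(b,j)} = [W a b = ω^{(i−j) mod 8}]`. -/
noncomputable def Bmat {κ : Type*} (W : Matrix κ κ ℂ) :
    Matrix (κ × Fin 8) (κ × Fin 8) ℂ :=
  Matrix.of fun p q => if W p.1 q.1 = omega ^ ((p.2 - q.2 : Fin 8) : ℕ) then 1 else 0

/-- The vertex set of the graph `g₀`: `{0,1} × [8] × {0,…,7}`, a qubit register, a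
clock register (labels `1,…,8`, represented by `Fin 8` with label `t ↔ index t−1` and
periodic convention `|9⟩ = |1⟩`), and an 8-level ancilla. -/
abbrev G0V := Fin 2 × Fin 8 × Fin 8

/-- `H_prop = Σ_{t=1}^{8}( (B(U_t)†)_{13} ⊗ (|t⟩⟨t+1|)_2 + (B(U_t))_{13} ⊗ (|t+1⟩⟨t|)_2 )`,
where `B(U_t)` is obtained from the matrix `−√2·U_t` by the substitution `ω^k ↦ S^k`. -/
noncomputable def Hprop0 : Matrix G0V G0V ℂ :=
  Matrix.of fun p q => ∑ t : Fin 8,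
    ((if p.2.1 = t ∧ q.2.1 = t + 1 then
        (Bmat ((-(Real.sqrt 2) : ℂ) • gate t))ᴴ (p.1, p.2.2) (q.1, q.2.2) else 0)
      + (if p.2.1 = t + 1 ∧ q.2.1 = t then
        Bmat ((-(Real.sqrt 2) : ℂ) • gate t) (p.1, p.2.2) (q.1, q.2.2) else 0))

/-- `H_penalty = 1 ⊗ 1 ⊗ (S³ + S⁴ + S⁵)`. -/
noncomputable def Hpen0 : Matrix G0V G0V ℂ :=
  Matrix.of fun p q =>
    if p.1 = q.1 ∧ p.2.1 = q.2.1 then (S8 ^ 3 + S8 ^ 4 + S8 ^ 5) p.2.2 q.2.2 else 0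

/-- The adjacency matrix `A(g₀) = H_prop + H_penalty` of the 128-vertex graph `g₀`. -/
noncomputable def Ag0 : Matrix G0V G0V ℂ := Hprop0 + Hpen0

/-- `e₁ = −1 − 3√2`. -/
noncomputable def e1 : ℝ := -1 - 3 * Real.sqrt 2

/-- Clock-register coefficients of the states `ψ_{z,0}`: the qubit register holds `|z⟩`
at clock labels `1,3,5,7` (indices `0,2,4,6`), `H|z⟩` at labels `2,8` (indices `1,7`),
and `HT|z⟩` at labels `4,6` (indices `3,5`). -/
noncomputable def clockCoef (z : Fin 2) (t : Fin 8) (x : Fin 2) : ℂ :=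
  if t = 0 ∨ t = 2 ∨ t = 4 ∨ t = 6 then (if x = z then 1 else 0)
  else if t = 1 ∨ t = 7 then Hmat x z
  else (Hmat * Tmat) x z

/-- The ground states `ψ_{z,a}` of `A(g₀)`:
`ψ_{z,0} = (1/√8)( |z⟩(|1⟩+|3⟩+|5⟩+|7⟩) + H|z⟩(|2⟩+|8⟩) + HT|z⟩(|4⟩+|6⟩) ) ⊗ |ω⟩` and
`ψ_{z,1} = (ψ_{z,0})^*` (entrywise complex conjugate). -/
noncomputable def psi (z a : Fin 2) : G0V → ℂ :=
  if a = 0 then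
    fun p => ((1 : ℝ) / Real.sqrt 8 : ℝ) * clockCoef z p.2.1 p.1 * omegaVec p.2.2
  else
    fun p => starRingEnd ℂ
      (((1 : ℝ) / Real.sqrt 8 : ℝ) * clockCoef z p.2.1 p.1 * omegaVec p.2.2)

end GG

namespace BH

variable {V : Type*} [Fintype V] [DecidableEq V]

/-- The operator `M` acting on the `w`-th factor of the `N`-fold tensor power
`(ℂ^V)^{⊗N}`, the latter identified with `ℂ^{V^N}`. -/
noncomputable def onFactor (N : ℕ) (M : Matrix V V ℂ) (w : Fin N) :
    Matrix (Fin N → V) (Fin N → V) ℂ :=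
  Matrix.of fun x y =>
    (if ∀ u, u ≠ w → x u = y u then (1 : ℂ) else 0) * M (x w) (y w)

/-- The Bose–Hubbard interaction term
`Σ_{k ∈ V} Σ_{w ≠ w'} (|k⟩⟨k|)^{(w)} (|k⟩⟨k|)^{(w')}`, a diagonal matrix whose diagonal
entry at a configuration `x : Fin N → V` counts the ordered pairs of distinct particles
sitting at a common vertex. -/
noncomputable def interaction (V : Type*) [DecidableEq V] (N : ℕ) :
    Matrix (Fin N → V) (Fin N → V) ℂ :=
  Matrix.of fun x y =>
    if x = y then
      (((Finset.univ : Finset (Fin N × Fin N)).filter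
          fun p => p.1 ≠ p.2 ∧ x p.1 = x p.2).card : ℂ)
    else 0

/-- The `N`-particle Bose–Hubbard Hamiltonian `H_G^N` (with hopping and interaction
strengths equal to `1`) for the graph with adjacency matrix `A`. -/
noncomputable def bhHam (A : Matrix V V ℂ) (N : ℕ) :
    Matrix (Fin N → V) (Fin N → V) ℂ :=
  (∑ w : Fin N, onFactor N A w) + interaction V N

/-- The bosonic (symmetric) subspace `Z_N(G)`: states invariant under every permutation
of the `N` tensor factors. -/
def symmStates (V : Type*) (N : ℕ) : Set ((Fin N → V) → ℂ) :=
  { ψ | ∀ σ : Equiv.Perm (Fin N), ∀ x : Fin N → V, ψ (x ∘ σ) = ψ x }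

/-- The ground energy (smallest eigenvalue) of the compression of a Hermitian matrix `H`
to a subspace given as a set `Z` of states: the infimum of the Rayleigh quotients
`⟨ψ, H ψ⟩` over unit vectors `ψ ∈ Z`. -/
noncomputable def groundEnergy {ι : Type*} [Fintype ι]
    (H : Matrix ι ι ℂ) (Z : Set (ι → ℂ)) : ℝ :=
  sInf { r : ℝ | ∃ ψ ∈ Z, dotProduct (star ψ) ψ = 1 ∧
    r = (dotProduct (star ψ) (H.mulVec ψ)).re }

/-- `μ(G)`: the smallest eigenvalue of the adjacency matrix `A = A(G)`. -/
noncomputable def mu (A : Matrix V V ℂ) : ℝ :=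
  groundEnergy A Set.univ

/-- `λ_N^1(G)`: the smallest eigenvalue of `H(G,N)`, the restriction of
`H_G^N − N μ(G)·1` to the symmetric subspace `Z_N(G)`. -/
noncomputable def lambda1 (A : Matrix V V ℂ) (N : ℕ) : ℝ :=
  groundEnergy (bhHam A N - ((N : ℂ) * (mu A : ℂ)) • 1) (symmStates V N)

end BH

namespace GG

/-- A node `(q, z, t)` of a gate diagram with `R` diagram elements. -/
abbrev GNode (R : ℕ) := Fin R × Fin 2 × Fin 8

/-- The vertex set `[R] × {0,1} × [8] × {0,…,7}` of a gate graph, grouped as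
(node, ancilla). -/
abbrev GGV (R : ℕ) := GNode R × Fin 8

/-- The term `(|u⟩+|v⟩)(⟨u|+⟨v|) ⊗ 1` contributed by an edge `{u, v}` of a gate
diagram. -/
noncomputable def edgeTerm {R : ℕ} (u v : GNode R) : Matrix (GGV R) (GGV R) ℂ :=
  Matrix.of fun p q =>
    if p.2 = q.2 then
      ((if p.1 = u then (1 : ℂ) else 0) + (if p.1 = v then (1 : ℂ) else 0))
        * ((if q.1 = u then (1 : ℂ) else 0) + (if q.1 = v then (1 : ℂ) else 0))
    else 0

lemma edgeTerm_symm {R : ℕ} (u v : GNode R) : edgeTerm u v = edgeTerm v u := by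
  funext p q
  simp only [edgeTerm, Matrix.of_apply]
  split_ifs <;> ring

/-- `h_ℰ = Σ_{{(q,z,t),(q',z',t')} ∈ ℰ} (|q,z,t⟩+|q',z',t'⟩)(⟨q,z,t|+⟨q',z',t'|) ⊗ 1`. -/
noncomputable def hE {R : ℕ} (E : Finset (Sym2 (GNode R))) : Matrix (GGV R) (GGV R) ℂ :=
  ∑ e ∈ E, Sym2.lift ⟨fun u v => edgeTerm u v, edgeTerm_symm⟩ e

/-- `h_𝒮 = Σ_{(q,z,t) ∈ 𝒮} |q,z,t⟩⟨q,z,t| ⊗ 1`. -/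
noncomputable def hS {R : ℕ} (S : Finset (GNode R)) : Matrix (GGV R) (GGV R) ℂ :=
  Matrix.of fun p q => if p.1 = q.1 ∧ p.1 ∈ S ∧ p.2 = q.2 then 1 else 0

/-- The adjacency matrix of the gate graph of a gate diagram:
`A(G) = 1 ⊗ A(g₀) + h_𝒮 + h_ℰ`. -/
noncomputable def AG {R : ℕ} (S : Finset (GNode R)) (E : Finset (Sym2 (GNode R))) :
    Matrix (GGV R) (GGV R) ℂ :=
  (Matrix.of fun p q : GGV R =>
    if p.1.1 = q.1.1 then Ag0 (p.1.2.1, p.1.2.2, p.2) (q.1.2.1, q.1.2.2, q.2) else 0)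
    + hS S + hE E

/-- Validity of a gate diagram: edges join distinct nodes, and each node carries at most
one edge or one self-loop and never both. -/
def ValidDiagram {R : ℕ} (S : Finset (GNode R)) (E : Finset (Sym2 (GNode R))) : Prop :=
  (∀ e ∈ E, ¬ e.IsDiag)
  ∧ (∀ v ∈ S, ∀ e ∈ E, v ∉ e)
  ∧ (∀ e ∈ E, ∀ e' ∈ E, e ≠ e' → ∀ v : GNode R, v ∈ e → v ∉ e')

/-- The single-particle state `ψ^q_{z,a} = |q⟩ ⊗ ψ_{z,a}`. -/
noncomputable def psiQ {R : ℕ} (q : Fin R) (z a : Fin 2) : GGV R → ℂ :=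
  fun p => (if p.1.1 = q then (1 : ℂ) else 0) * psi z a (p.1.2.1, p.1.2.2, p.2)

/-- The symmetrization `Sym(φ₁ ⊗ ⋯ ⊗ φ_N) = (1/√N!) Σ_{σ ∈ S_N} φ_{σ(1)} ⊗ ⋯ ⊗ φ_{σ(N)}`
of a product state. -/
noncomputable def symSt {ι : Type*} (N : ℕ) (φ : Fin N → (ι → ℂ)) : (Fin N → ι) → ℂ :=
  fun x => ((1 : ℝ) / Real.sqrt (N.factorial) : ℝ)
    * ∑ σ : Equiv.Perm (Fin N), ∏ w : Fin N, φ (σ w) (x w)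

/-- The subspace
`I(G,N) = span{ Sym(ψ^{q₁}_{z₁,a₁} ⊗ ⋯ ⊗ ψ^{q_N}_{z_N,a_N}) : q₁,…,q_N pairwise distinct }`. -/
noncomputable def Ispace (R N : ℕ) : Submodule ℂ ((Fin N → GGV R) → ℂ) :=
  Submodule.span ℂ
    { v | ∃ (z a : Fin N → Fin 2) (q : Fin N → Fin R),
        Function.Injective q ∧ v = symSt N (fun w => psiQ (q w) (z w) (a w)) }

end GG

open GG

namespace FF

lemma omega_eq : omega = ((Real.sqrt 2 / 2 : ℝ) : ℂ) * (1 + Complex.I) := by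
  have h : (Real.pi * Complex.I / 4 : ℂ) = ((Real.pi / 4 : ℝ) : ℂ) * Complex.I := by
    push_cast; ring
  rw [omega, h, Complex.exp_mul_I, ← Complex.ofReal_cos, ← Complex.ofReal_sin,
    Real.cos_pi_div_four, Real.sin_pi_div_four]
  ring

lemma omega_prim : IsPrimitiveRoot omega 8 := by
  have h := Complex.isPrimitiveRoot_exp 8 (by norm_num)
  have e : omega = Complex.exp (2 * Real.pi * Complex.I / ((8 : ℕ) : ℂ)) := by
    rw [omega]; congr 1; push_cast; ring
  rw [e]; exact h

lemma sqrt2_sq : ((Real.sqrt 2 : ℝ) : ℂ) ^ 2 = 2 := by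
  rw [← Complex.ofReal_pow, Real.sq_sqrt (by norm_num)]; norm_num

lemma sqrt2_ne : ((Real.sqrt 2 : ℝ) : ℂ) ≠ 0 := by
  intro h; have := sqrt2_sq; rw [h] at this; norm_num at this

lemma omega_sq : omega ^ 2 = Complex.I := by
  rw [omega_eq]
  push_cast
  have h2 := sqrt2_sq
  linear_combination (1 + Complex.I) ^ 2 / 4 * h2 + (1 / 2) * Complex.I_sq

lemma omega_four : omega ^ 4 = -1 := by
  rw [show omega ^ 4 = (omega ^ 2) ^ 2 by ring, omega_sq, Complex.I_sq]

lemma omega_ne : omega ≠ 0 := by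
  intro h; have := omega_four; rw [h] at this; norm_num at this

lemma conj_omega : (starRingEnd ℂ) omega = -omega ^ 3 := by
  have : omega ^ 3 = omega ^ 2 * omega := by ring
  rw [this, omega_sq, omega_eq]
  simp only [map_mul, Complex.conj_ofReal, map_add, map_one, Complex.conj_I]
  linear_combination (Real.sqrt 2 / 2 : ℝ) * Complex.I_sq

lemma omega_add : omega - omega ^ 3 = (Real.sqrt 2 : ℝ) := by
  rw [show omega ^ 3 = omega ^ 2 * omega by ring, omega_sq, omega_eq]
  push_cast
  linear_combination (-Real.sqrt 2 / 2 : ℂ) * Complex.I_sq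

/-- Exponents for `H`. -/
def kH (a b : Fin 2) : Fin 8 := if a = 1 ∧ b = 1 then 0 else 4
/-- Exponents for `HT`. -/
def kHT (a b : Fin 2) : Fin 8 := if b = 0 then 4 else if a = 0 then 5 else 1
/-- Exponents for the adjoint of `HT`. -/
def kHTd (a b : Fin 2) : Fin 8 := if a = 0 then 4 else if b = 0 then 3 else 7

/-- The table of exponents. -/
def kap : Fin 8 → Fin 2 → Fin 2 → Fin 8 :=
  ![kH, kH, kHT, kHTd, kHT, kHTd, kH, kH]

lemma gate_cases (t : Fin 8) : (gate t = Hmat ∧ kap t = kH) ∨ (gate t = Hmat * Tmat ∧ kap t = kHT)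
    ∨ (gate t = (Hmat * Tmat)ᴴ ∧ kap t = kHTd) := by
  match t with
  | 0 => exact Or.inl ⟨rfl, rfl⟩
  | 1 => exact Or.inl ⟨rfl, rfl⟩
  | 2 => exact Or.inr (Or.inl ⟨rfl, rfl⟩)
  | 3 => exact Or.inr (Or.inr ⟨rfl, rfl⟩)
  | 4 => exact Or.inr (Or.inl ⟨rfl, rfl⟩)
  | 5 => exact Or.inr (Or.inr ⟨rfl, rfl⟩)
  | 6 => exact Or.inl ⟨rfl, rfl⟩
  | 7 => exact Or.inl ⟨rfl, rfl⟩

lemma Hmat_apply (a b : Fin 2) : (-(Real.sqrt 2) : ℂ) * Hmat a b =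
    if a = 1 ∧ b = 1 then 1 else -1 := by
  have h := sqrt2_ne
  fin_cases a <;> fin_cases b <;> simp [Hmat] <;> field_simp

lemma HT_apply (a b : Fin 2) : (-(Real.sqrt 2) : ℂ) * (Hmat * Tmat) a b =
    if b = 0 then -1 else if a = 0 then -omega else omega := by
  have h := sqrt2_ne
  fin_cases a <;> fin_cases b <;> simp [Hmat, Tmat, Matrix.mul_apply, Fin.sum_univ_two] <;> field_simp

lemma gate_apply (t : Fin 8) (a b : Fin 2) :
    (-(Real.sqrt 2) : ℂ) * gate t a b = omega ^ (kap t a b : ℕ) := by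
  have h4 := omega_four
  have h5 : omega ^ 5 = -omega := by rw [show omega ^ 5 = omega ^ 4 * omega by ring, h4]; ring
  have h7 : omega ^ 7 = -omega ^ 3 := by
    rw [show omega ^ 7 = omega ^ 4 * omega ^ 3 by ring, h4]; ring
  have hH := Hmat_apply
  have hT := HT_apply
  have hTd : ∀ a b, (-(Real.sqrt 2) : ℂ) * (Hmat * Tmat)ᴴ a b =
      if a = 0 then -1 else if b = 0 then omega ^ 3 else -omega ^ 3 := by
    intro a b
    have := congrArg (starRingEnd ℂ) (HT_apply b a)
    rw [Matrix.conjTranspose_apply]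
    simp only [map_mul, map_neg, Complex.conj_ofReal] at this
    refine Eq.trans this ?_
    split_ifs <;> simp [conj_omega]
  rcases gate_cases t with ⟨h, h'⟩ | ⟨h, h'⟩ | ⟨h, h'⟩
  · rw [h, h', hH, kH]; split_ifs
    · exact (pow_zero _).symm
    · exact h4.symm
  · rw [h, h', hT, kHT]; split_ifs
    · exact h4.symm
    · exact h5.symm
    · exact (pow_one _).symm
  · rw [h, h', hTd, kHTd]; split_ifs
    · exact h4.symm
    · rfl
    · exact h7.symm

lemma Bmat_gate (t : Fin 8) (a b : Fin 2) (i j : Fin 8) :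
    Bmat ((-(Real.sqrt 2) : ℂ) • gate t) (a, i) (b, j) =
      if i = j + kap t a b then 1 else 0 := by
  simp only [Bmat, Matrix.of_apply, Matrix.smul_apply, smul_eq_mul, gate_apply]
  congr 1
  apply propext
  constructor
  · intro h
    have := omega_prim.pow_inj (kap t a b).isLt (i - j).isLt h
    have := Fin.ext this
    rw [this]; abel
  · intro h
    rw [h]; simp

lemma Hprop0_apply (x x' : Fin 2) (t t' j j' : Fin 8) :
    Hprop0 (x, t, j) (x', t', j') =
      (if t' = t + 1 then if j' = j + kap t x' x then (1 : ℂ) else 0 else 0) +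
      (if t' = t - 1 then if j' = j - kap t' x x' then (1 : ℂ) else 0 else 0) := by
  simp only [Hprop0, Matrix.of_apply, Finset.sum_add_distrib, Matrix.conjTranspose_apply, Bmat_gate]
  congr 1
  · rw [Finset.sum_eq_single t]
    · simp only [true_and]; split_ifs <;> simp
    · intro b _ hb; rw [if_neg]; rintro ⟨h, -⟩; exact hb h.symm
    · simp
  · rw [Finset.sum_eq_single t']
    · simp only [and_true, eq_sub_iff_add_eq]
      split_ifs <;> simp_all
    · intro b _ hb; rw [if_neg]; rintro ⟨-, h⟩; exact hb h.symm
    · simp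

lemma S8_pow (n : ℕ) (i j : Fin 8) :
    (S8 ^ n) i j = if j = i - Fin.ofNat 8 n then (1 : ℂ) else 0 := by
  induction n generalizing i j with
  | zero => simp [Matrix.one_apply, eq_comm]
  | succ n ih =>
    rw [pow_succ, Matrix.mul_apply]
    simp only [ih]
    simp only [S8, Matrix.of_apply, ite_mul, one_mul, zero_mul, Finset.sum_ite_eq', Finset.sum_ite_eq,
      Finset.mem_univ, if_true]
    congr 1
    apply propext
    have h1 : Fin.ofNat 8 (n + 1) = Fin.ofNat 8 n + 1 := by
      apply Fin.ext; simp [Fin.val_add]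
    rw [h1, ← sub_sub]
    constructor
    · intro h; rw [h]; simp
    · intro h; rw [h]; simp

lemma Hpen0_apply (x x' : Fin 2) (t t' j j' : Fin 8) :
    Hpen0 (x, t, j) (x', t', j') =
      if x' = x then if t' = t then
        ((if j' = j + 5 then (1 : ℂ) else 0) + (if j' = j + 4 then (1 : ℂ) else 0) +
          (if j' = j + 3 then (1 : ℂ) else 0)) else 0 else 0 := by
  simp only [Hpen0, Matrix.of_apply, Matrix.add_apply, S8_pow]
  have h3 : j - Fin.ofNat 8 3 = j + 5 := by revert j; decide
  have h4 : j - Fin.ofNat 8 4 = j + 4 := by revert j; decide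
  have h5 : j - Fin.ofNat 8 5 = j + 3 := by revert j; decide
  rw [h3, h4, h5, ite_and]
  simp only [eq_comm]

lemma Ag0_mulVec (v : G0V → ℂ) (x : Fin 2) (t j : Fin 8) :
    (Ag0 *ᵥ v) (x, t, j) =
      ∑ x', v (x', t + 1, j + kap t x' x) + ∑ x', v (x', t - 1, j - kap (t - 1) x x')
      + (v (x, t, j + 5) + v (x, t, j + 4) + v (x, t, j + 3)) := by
  simp only [Matrix.mulVec, dotProduct, Ag0, Matrix.add_apply, Fintype.sum_prod_type, Hprop0_apply,
    Hpen0_apply, add_mul, ite_mul, one_mul, zero_mul, Finset.sum_add_distrib, Finset.sum_ite_eq,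
    Finset.sum_ite_eq', Finset.mem_univ, if_true]
  simp [Finset.sum_ite_irrel, Finset.sum_add_distrib, add_mul, ite_mul]

lemma Ag0_herm : Ag0ᴴ = Ag0 := by
  ext p q
  obtain ⟨x, t, j⟩ := p
  obtain ⟨x', t', j'⟩ := q
  have hp : ∀ p q, star (Hprop0 p q) = Hprop0 q p := by
    intro p q
    simp only [Hprop0, Matrix.of_apply, Matrix.conjTranspose_apply, star_sum]
    refine Finset.sum_congr rfl fun t _ => ?_
    rw [star_add, add_comm]
    congr 1 <;> split_ifs <;> simp_all
  have h3 : ∀ i k : Fin 8, k = i + 5 ↔ i = k + 3 := by decide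
  have h4 : ∀ i k : Fin 8, k = i + 4 ↔ i = k + 4 := by decide
  rw [Matrix.conjTranspose_apply, Ag0, Matrix.add_apply, Matrix.add_apply, star_add, hp]
  congr 1
  rw [Hpen0_apply, Hpen0_apply]
  have k3 := h3 j' j
  have k3' := h3 j j'
  have k4 := h4 j' j
  have kx := eq_comm (a := x) (b := x')
  have kt := eq_comm (a := t) (b := t')
  simp only [k3, k4, ← k3', kx, kt]
  split_ifs <;> simp

end FF

namespace FF

/-- Real inner product on `ℂ`. -/
def rr (a b : ℂ) : ℝ := a.re * b.re + a.im * b.im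

lemma rr_comm (a b : ℂ) : rr a b = rr b a := by unfold rr; ring

lemma rr_self_nonneg (a : ℂ) : 0 ≤ rr a a := by
  unfold rr; nlinarith [mul_self_nonneg a.re, mul_self_nonneg a.im]

lemma rr_self_eq_zero {a : ℂ} (h : rr a a = 0) : a = 0 := by
  unfold rr at h
  have h1 : a.re = 0 := by nlinarith [mul_self_nonneg a.re, mul_self_nonneg a.im]
  have h2 : a.im = 0 := by nlinarith [mul_self_nonneg a.re, mul_self_nonneg a.im]
  exact Complex.ext h1 h2

lemma star_mul_re (a b : ℂ) : (star a * b).re = rr a b := by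
  simp [rr]

lemma rr_add_right (a b c : ℂ) : rr a (b + c) = rr a b + rr a c := by
  simp only [rr, Complex.add_re, Complex.add_im]; ring

lemma rr_add_left (a b c : ℂ) : rr (b + c) a = rr b a + rr c a := by
  simp only [rr, Complex.add_re, Complex.add_im]; ring

lemma rr_sub_right (a b c : ℂ) : rr a (b - c) = rr a b - rr a c := by
  simp only [rr, Complex.sub_re, Complex.sub_im]; ring

lemma rr_sub_left (a b c : ℂ) : rr (b - c) a = rr b a - rr c a := by
  simp only [rr, Complex.sub_re, Complex.sub_im]; ring

lemma rr_smul_left (r : ℝ) (a b : ℂ) : rr ((r : ℂ) * a) b = r * rr a b := by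
  simp [rr]; ring

lemma rr_smul_right (r : ℝ) (a b : ℂ) : rr a ((r : ℂ) * b) = r * rr a b := by
  simp [rr]; ring

lemma rr_neg_left (a b : ℂ) : rr (-a) b = - rr a b := by
  simp [rr]; ring

lemma rr_neg_right (a b : ℂ) : rr a (-b) = - rr a b := by
  simp [rr]; ring

lemma rr_sum_right {ι : Type*} (s : Finset ι) (a : ℂ) (f : ι → ℂ) :
    rr a (∑ i ∈ s, f i) = ∑ i ∈ s, rr a (f i) := by
  simp only [rr, Complex.re_sum, Complex.im_sum, Finset.mul_sum, Finset.sum_add_distrib]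

/-- Correlation. -/
def corr (f g : Fin 8 → ℂ) (c : Fin 8) : ℝ := ∑ j, rr (f j) (g (j + c))

lemma sum_shift {M : Type*} [AddCommMonoid M] (F : Fin 8 → M) (c : Fin 8) : ∑ j, F (j + c) = ∑ j, F j :=
  Equiv.sum_comp (Equiv.addRight c) F

lemma corr_shift (f g : Fin 8 → ℂ) (a b : Fin 8) :
    ∑ j, rr (f (j + a)) (g (j + b)) = corr f g (b - a) := by
  unfold corr
  rw [← sum_shift (fun j => rr (f j) (g (j + (b - a)))) a]
  refine Finset.sum_congr rfl fun j _ => ?_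
  rw [show j + a + (b - a) = j + b by abel]

lemma corr_neg (f g : Fin 8 → ℂ) (c : Fin 8) : corr f g (-c) = corr g f c := by
  have := corr_shift f g c 0
  rw [zero_sub] at this
  rw [← this]
  unfold corr
  exact Finset.sum_congr rfl fun j _ => by rw [rr_comm]; simp

lemma corr_self_nonneg (f : Fin 8 → ℂ) : 0 ≤ corr f f 0 := by
  unfold corr
  exact Finset.sum_nonneg fun j _ => by simpa using rr_self_nonneg (f j)

lemma corr_self_eq_zero {f : Fin 8 → ℂ} (h : corr f f 0 = 0) : f = 0 := by
  unfold corr at h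
  rw [Finset.sum_eq_zero_iff_of_nonneg
    (fun j _ => by simpa using rr_self_nonneg (f j))] at h
  funext j
  exact rr_self_eq_zero (by simpa using h j (Finset.mem_univ j))

/-- Even part. -/
noncomputable def ev (f : Fin 8 → ℂ) : Fin 8 → ℂ := fun j => ((1 / 2 : ℝ) : ℂ) * (f j + f (j + 4))
/-- Odd part. -/
noncomputable def od (f : Fin 8 → ℂ) : Fin 8 → ℂ := fun j => ((1 / 2 : ℝ) : ℂ) * (f j - f (j + 4))

lemma add44 (j : Fin 8) : j + 4 + 4 = j := by revert j; decide

lemma ev_even (f : Fin 8 → ℂ) (j : Fin 8) : ev f (j + 4) = ev f j := by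
  simp only [ev, add44, add_comm (f (j + 4))]

lemma od_odd (f : Fin 8 → ℂ) (j : Fin 8) : od f (j + 4) = - od f j := by
  simp only [od, add44]; ring

lemma ev_add_od (f : Fin 8 → ℂ) (j : Fin 8) : ev f j + od f j = f j := by
  simp only [ev, od]; push_cast; ring

lemma corr_split (f g : Fin 8 → ℂ) (c : Fin 8) :
    corr f g c = corr (ev f) (ev g) c + corr (od f) (od g) c := by
  have h : corr f g c = (1 / 2) * (∑ j, rr (f j) (g (j + c))
      + ∑ j, rr (f (j + 4)) (g (j + 4 + c))) := by
    rw [sum_shift (fun j => rr (f j) (g (j + c)))]; unfold corr; ring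
  rw [h, ← Finset.sum_add_distrib, Finset.mul_sum]
  unfold corr
  rw [← Finset.sum_add_distrib]
  refine Finset.sum_congr rfl fun j _ => ?_
  simp only [ev, od, rr_smul_left, rr_smul_right, rr_add_left, rr_add_right, rr_sub_left,
    rr_sub_right, add_right_comm j c 4]
  ring

lemma corr_bound (f g : Fin 8 → ℂ) (c : Fin 8) :
    0 ≤ 2 * corr f g c + corr f f 0 + corr g g 0 := by
  have h : 2 * corr f g c + corr f f 0 + corr g g 0 =
      ∑ j, rr (f j + g (j + c)) (f j + g (j + c)) := by
    have := corr_shift g g c c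
    rw [sub_self] at this
    rw [← this]
    unfold corr
    rw [Finset.mul_sum, ← Finset.sum_add_distrib, ← Finset.sum_add_distrib]
    refine Finset.sum_congr rfl fun j _ => ?_
    simp only [rr_add_left, rr_add_right, add_zero]
    rw [rr_comm (g (j + c)) (f j)]; ring
  rw [h]
  exact Finset.sum_nonneg fun j _ => rr_self_nonneg _

/-- The quadratic form. -/
noncomputable def qfw (w : Fin 2 → Fin 8 → Fin 8 → ℂ) : ℝ :=
  (∑ t, ∑ x, ∑ x', 2 * corr (w x t) (w x' (t + 1)) (kap t x' x)) +
  ∑ x, ∑ t, (2 * corr (w x t) (w x t) 3 + corr (w x t) (w x t) 4)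

/-- The squared norm. -/
noncomputable def nw (w : Fin 2 → Fin 8 → Fin 8 → ℂ) : ℝ := ∑ x, ∑ t, corr (w x t) (w x t) 0

lemma qf_eq (v : G0V → ℂ) :
    (star v ⬝ᵥ (Ag0 *ᵥ v)).re = qfw (fun x t j => v (x, t, j)) := by
  have hre : (star v ⬝ᵥ (Ag0 *ᵥ v)).re = ∑ p, rr (v p) ((Ag0 *ᵥ v) p) := by
    simp only [dotProduct, Complex.re_sum, Pi.star_apply, star_mul_re]
  rw [hre]
  simp only [Fintype.sum_prod_type, Ag0_mulVec, rr_add_right, rr_sum_right, Finset.sum_add_distrib]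
  have h1 : ∑ x, ∑ t, ∑ j, ∑ x', rr (v (x, t, j)) (v (x', t + 1, j + kap t x' x)) =
      ∑ t, ∑ x, ∑ x', corr (fun j => v (x, t, j)) (fun j => v (x', t + 1, j)) (kap t x' x) := by
    rw [Finset.sum_comm]
    refine Finset.sum_congr rfl fun t _ => Finset.sum_congr rfl fun x _ => ?_
    rw [Finset.sum_comm]; rfl
  have h2 : ∑ x, ∑ t, ∑ j, ∑ x', rr (v (x, t, j)) (v (x', t - 1, j - kap (t - 1) x x')) =
      ∑ t, ∑ x, ∑ x', corr (fun j => v (x, t, j)) (fun j => v (x', t + 1, j)) (kap t x' x) := by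
    rw [Finset.sum_comm]
    rw [← sum_shift _ 1]
    refine Finset.sum_congr rfl fun t _ => ?_
    simp only [add_sub_cancel_right]
    have : ∀ x, ∑ j, ∑ x', rr (v (x, t + 1, j)) (v (x', t, j - kap t x x')) =
        ∑ x', corr (fun j => v (x', t, j)) (fun j => v (x, t + 1, j)) (kap t x x') := by
      intro x
      rw [Finset.sum_comm]
      refine Finset.sum_congr rfl fun x' _ => ?_
      rw [← sum_shift _ (kap t x x')]
      simp only [add_sub_cancel_right]
      exact Finset.sum_congr rfl fun j _ => rr_comm _ _
    simp only [this]
    rw [Finset.sum_comm]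
  have h5 : ∀ x t, ∑ j, rr (v (x, t, j)) (v (x, t, j + 5)) =
      corr (fun j => v (x, t, j)) (fun j => v (x, t, j)) 3 := by
    intro x t
    rw [← corr_neg]; rfl
  rw [h1, h2]
  simp only [h5]
  unfold qfw
  simp only [Finset.sum_add_distrib, ← Finset.mul_sum]
  have h3 : ∀ x t, ∑ j, rr (v (x, t, j)) (v (x, t, j + 3)) =
      corr (fun j => v (x, t, j)) (fun j => v (x, t, j)) 3 := fun _ _ => rfl
  have h4 : ∀ x t, ∑ j, rr (v (x, t, j)) (v (x, t, j + 4)) =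
      corr (fun j => v (x, t, j)) (fun j => v (x, t, j)) 4 := fun _ _ => rfl
  simp only [h3, h4]
  ring

lemma qfw_split (w : Fin 2 → Fin 8 → Fin 8 → ℂ) :
    qfw w = qfw (fun x t => ev (w x t)) + qfw (fun x t => od (w x t)) := by
  unfold qfw
  simp only [corr_split (w _ _), mul_add, Finset.sum_add_distrib]
  ring

lemma nw_split (w : Fin 2 → Fin 8 → Fin 8 → ℂ) :
    nw w = nw (fun x t => ev (w x t)) + nw (fun x t => od (w x t)) := by
  unfold nw
  simp only [corr_split (w _ _), Finset.sum_add_distrib]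

lemma nw_next (w : Fin 2 → Fin 8 → Fin 8 → ℂ) :
    ∑ t, ∑ x, corr (w x (t + 1)) (w x (t + 1)) 0 = nw w := by
  rw [sum_shift (fun t => ∑ x, corr (w x t) (w x t) 0), Finset.sum_comm]; rfl

lemma nw_this (w : Fin 2 → Fin 8 → Fin 8 → ℂ) :
    ∑ t, ∑ x, corr (w x t) (w x t) 0 = nw w := by
  rw [Finset.sum_comm]; rfl

lemma qfw_even (w : Fin 2 → Fin 8 → Fin 8 → ℂ) (hw : ∀ x t j, w x t (j + 4) = w x t j) :
    -5 * nw w ≤ qfw w := by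
  have h1 : -4 * nw w ≤ ∑ t, ∑ x, ∑ x', 2 * corr (w x t) (w x' (t + 1)) (kap t x' x) := by
    have : -4 * nw w = ∑ t, ∑ x : Fin 2, ∑ x' : Fin 2,
        (-(corr (w x t) (w x t) 0) - corr (w x' (t + 1)) (w x' (t + 1)) 0) := by
      have a := nw_next w
      have b := nw_this w
      simp only [Fin.sum_univ_two, Finset.sum_add_distrib, Finset.sum_sub_distrib, Finset.sum_neg_distrib] at a b ⊢
      linarith
    rw [this]
    refine Finset.sum_le_sum fun t _ => Finset.sum_le_sum fun x _ => Finset.sum_le_sum fun x' _ => ?_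
    linarith [corr_bound (w x t) (w x' (t + 1)) (kap t x' x)]
  have h2 : -1 * nw w ≤ ∑ x, ∑ t, (2 * corr (w x t) (w x t) 3 + corr (w x t) (w x t) 4) := by
    unfold nw
    rw [Finset.mul_sum]
    refine Finset.sum_le_sum fun x _ => ?_
    rw [Finset.mul_sum]
    refine Finset.sum_le_sum fun t _ => ?_
    have e4 : corr (w x t) (w x t) 4 = corr (w x t) (w x t) 0 := by
      unfold corr; simp only [hw, add_zero]
    linarith [corr_bound (w x t) (w x t) 3]
  unfold qfw
  linarith

lemma corr_odd (f g : Fin 8 → ℂ) (hg : ∀ j, g (j + 4) = - g j) (c : Fin 8) :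
    corr f g (c + 4) = - corr f g c := by
  unfold corr
  simp only [← add_assoc, hg, rr_neg_right, Finset.sum_neg_distrib]

/-- Step defect. -/
noncomputable def dstep (w : Fin 2 → Fin 8 → Fin 8 → ℂ) (t : Fin 8) (x' : Fin 2) (j : Fin 8) : ℂ :=
  ((Real.sqrt 2 : ℝ) : ℂ) * w x' (t + 1) j + ∑ x, w x t (j - kap t x' x)

/-- Ancilla defect. -/
noncomputable def danc (w : Fin 2 → Fin 8 → Fin 8 → ℂ) (t : Fin 8) (x : Fin 2) (j : Fin 8) : ℂ :=
  ((Real.sqrt 2 : ℝ) : ℂ) * w x t j - w x t (j + 1) - w x t (j - 1)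

lemma dstep_sum (w : Fin 2 → Fin 8 → Fin 8 → ℂ) (hw : ∀ x t j, w x t (j + 4) = - w x t j) (t : Fin 8) :
    ∑ x', ∑ j, rr (dstep w t x' j) (dstep w t x' j) =
      2 * ∑ x, corr (w x (t + 1)) (w x (t + 1)) 0 + 2 * ∑ x, corr (w x t) (w x t) 0
      + Real.sqrt 2 * ∑ x, ∑ x', 2 * corr (w x t) (w x' (t + 1)) (kap t x' x) := by
  have s2 : Real.sqrt 2 * Real.sqrt 2 = 2 := Real.mul_self_sqrt (by norm_num)
  have hx : ∀ x', ∑ j, rr (dstep w t x' j) (dstep w t x' j) =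
      2 * corr (w x' (t + 1)) (w x' (t + 1)) 0 + corr (w 0 t) (w 0 t) 0 + corr (w 1 t) (w 1 t) 0
      + Real.sqrt 2 * (2 * corr (w 0 t) (w x' (t + 1)) (kap t x' 0)
        + 2 * corr (w 1 t) (w x' (t + 1)) (kap t x' 1))
      + 2 * corr (w 0 t) (w 1 t) (kap t x' 0 - kap t x' 1) := by
    intro x'
    have a0 := corr_shift (w 0 t) (w 0 t) (- kap t x' 0) (- kap t x' 0)
    have a1 := corr_shift (w 1 t) (w 1 t) (- kap t x' 1) (- kap t x' 1)
    have b0 := corr_shift (w 0 t) (w x' (t + 1)) (- kap t x' 0) 0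
    have b1 := corr_shift (w 1 t) (w x' (t + 1)) (- kap t x' 1) 0
    have c0 := corr_shift (w 0 t) (w 1 t) (- kap t x' 0) (- kap t x' 1)
    have d0 := corr_shift (w x' (t + 1)) (w x' (t + 1)) 0 0
    rw [sub_self] at a0 a1 d0
    rw [zero_sub, neg_neg] at b0 b1
    rw [show - kap t x' 1 - - kap t x' 0 = kap t x' 0 - kap t x' 1 by abel] at c0
    rw [← a0, ← a1, ← b0, ← b1, ← c0, ← d0]
    simp only [Finset.mul_sum, ← Finset.sum_add_distrib]
    refine Finset.sum_congr rfl fun j _ => ?_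
    simp only [dstep, Fin.sum_univ_two, rr_add_left, rr_add_right, rr_smul_left, rr_smul_right,
      ← sub_eq_add_neg, add_zero]
    rw [rr_comm (w 1 t _) (w 0 t _), rr_comm (w x' (t + 1) j) (w 0 t _), rr_comm (w x' (t + 1) j) (w 1 t _)]
    linear_combination (rr (w x' (t + 1) j) (w x' (t + 1) j)) * s2
  have hk : kap t 1 0 - kap t 1 1 = kap t 0 0 - kap t 0 1 + 4 := by
    clear hx; revert t; decide
  have hc : corr (w 0 t) (w 1 t) (kap t 1 0 - kap t 1 1) =
      - corr (w 0 t) (w 1 t) (kap t 0 0 - kap t 0 1) := by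
    rw [hk, corr_odd _ _ (hw 1 t)]
  simp only [hx, Fin.sum_univ_two, hc]
  ring

lemma danc_sum (w : Fin 2 → Fin 8 → Fin 8 → ℂ) (hw : ∀ x t j, w x t (j + 4) = - w x t j)
    (t : Fin 8) (x : Fin 2) :
    ∑ j, rr (danc w t x j) (danc w t x j) =
      4 * corr (w x t) (w x t) 0 - 4 * Real.sqrt 2 * corr (w x t) (w x t) 1 := by
  have s2 : Real.sqrt 2 * Real.sqrt 2 = 2 := Real.mul_self_sqrt (by norm_num)
  have a := corr_shift (w x t) (w x t) 0 0
  have b := corr_shift (w x t) (w x t) 1 1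
  have c := corr_shift (w x t) (w x t) (-1) (-1)
  have d := corr_shift (w x t) (w x t) 0 1
  have e := corr_shift (w x t) (w x t) (-1) 0
  have f := corr_shift (w x t) (w x t) (-1) 1
  have h2 : corr (w x t) (w x t) (1 - -1) = 0 := by
    have h := corr_neg (w x t) (w x t) 2
    have h' := corr_odd (w x t) (w x t) (hw x t) 2
    have e1 : (2 : Fin 8) + 4 = -2 := by decide
    have e2 : (1 - -1 : Fin 8) = 2 := by decide
    rw [e1] at h'
    rw [e2]; linarith
  rw [h2] at f
  rw [sub_self] at a b c
  rw [sub_zero] at d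
  rw [zero_sub, neg_neg] at e
  have key : 4 * corr (w x t) (w x t) 0 - 4 * Real.sqrt 2 * corr (w x t) (w x t) 1 =
    2 * corr (w x t) (w x t) 0 + corr (w x t) (w x t) 0 + corr (w x t) (w x t) 0
      - 2 * Real.sqrt 2 * corr (w x t) (w x t) 1
      - 2 * Real.sqrt 2 * corr (w x t) (w x t) 1 + 2 * 0 := by ring
  rw [key]
  nth_rewrite 1 [← a]
  nth_rewrite 1 [← b]
  nth_rewrite 1 [← c]
  nth_rewrite 1 [← d]
  nth_rewrite 1 [← e]
  rw [← f]
  simp only [Finset.mul_sum, ← Finset.sum_add_distrib, ← Finset.sum_sub_distrib]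
  refine Finset.sum_congr rfl fun j _ => ?_
  simp only [danc, rr_sub_left, rr_sub_right, rr_smul_left, rr_smul_right, ← sub_eq_add_neg, add_zero]
  rw [rr_comm (w x t (j + 1)) (w x t j), rr_comm (w x t (j + 1)) (w x t (j - 1)),
    rr_comm (w x t (j - 1)) (w x t j)]
  linear_combination (rr (w x t j) (w x t j)) * s2

lemma qfw_odd (w : Fin 2 → Fin 8 → Fin 8 → ℂ) (hw : ∀ x t j, w x t (j + 4) = - w x t j) :
    2 * Real.sqrt 2 * (qfw w - e1 * nw w) =
      2 * (∑ t, ∑ x', ∑ j, rr (dstep w t x' j) (dstep w t x' j))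
      + ∑ x, ∑ t, ∑ j, rr (danc w t x j) (danc w t x j) := by
  have s2 : Real.sqrt 2 * Real.sqrt 2 = 2 := Real.mul_self_sqrt (by norm_num)
  simp only [dstep_sum w hw, danc_sum w hw]
  have e3 : ∀ x t, 2 * corr (w x t) (w x t) 3 + corr (w x t) (w x t) 4 =
      -2 * corr (w x t) (w x t) 1 - corr (w x t) (w x t) 0 := by
    intro x t
    have a := corr_odd (w x t) (w x t) (hw x t) (-1)
    have b := corr_odd (w x t) (w x t) (hw x t) 0
    rw [show (-1 + 4 : Fin 8) = 3 by decide, corr_neg] at a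
    rw [zero_add] at b
    linarith
  unfold qfw
  simp only [e3]
  have a := nw_next w
  have b := nw_this w
  simp only [Finset.sum_add_distrib, Finset.sum_sub_distrib, ← Finset.mul_sum] at a b ⊢
  rw [a, b]
  unfold e1
  have hn : ∑ x, ∑ t, corr (w x t) (w x t) 0 = nw w := rfl
  rw [hn]
  linear_combination (6 * nw w) * s2

lemma dzero {w : Fin 2 → Fin 8 → Fin 8 → ℂ} (F : (Fin 2 → Fin 8 → Fin 8 → ℂ) → Fin 8 → Fin 2 → Fin 8 → ℂ)
    (h : ∑ t, ∑ x', ∑ j, rr (F w t x' j) (F w t x' j) = 0) : ∀ t x j, F w t x j = 0 := by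
  intro t x j
  apply rr_self_eq_zero
  rw [Finset.sum_eq_zero_iff_of_nonneg (fun t _ => Finset.sum_nonneg fun x _ =>
    Finset.sum_nonneg fun j _ => rr_self_nonneg _)] at h
  have h := h t (Finset.mem_univ _)
  rw [Finset.sum_eq_zero_iff_of_nonneg (fun x _ =>
    Finset.sum_nonneg fun j _ => rr_self_nonneg _)] at h
  have h := h x (Finset.mem_univ _)
  rw [Finset.sum_eq_zero_iff_of_nonneg (fun j _ => rr_self_nonneg _)] at h
  exact h j (Finset.mem_univ _)

/-- The linear equations characterising the ground space of `A(g₀)`. -/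
def Good (w : Fin 2 → Fin 8 → Fin 8 → ℂ) : Prop :=
  (∀ t x j, dstep w t x j = 0) ∧ (∀ t x j, danc w t x j = 0)

lemma nw_nonneg (w : Fin 2 → Fin 8 → Fin 8 → ℂ) : 0 ≤ nw w :=
  Finset.sum_nonneg fun _ _ => Finset.sum_nonneg fun _ _ => corr_self_nonneg _

lemma nw_zero {w : Fin 2 → Fin 8 → Fin 8 → ℂ} (h : nw w = 0) (x t) : w x t = 0 := by
  unfold nw at h
  rw [Finset.sum_eq_zero_iff_of_nonneg (fun t _ => Finset.sum_nonneg fun x _ => corr_self_nonneg _)] at h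
  have h := h x (Finset.mem_univ _)
  rw [Finset.sum_eq_zero_iff_of_nonneg (fun j _ => corr_self_nonneg _)] at h
  exact corr_self_eq_zero (h t (Finset.mem_univ _))

lemma main_g0 (w : Fin 2 → Fin 8 → Fin 8 → ℂ) :
    0 ≤ qfw w - e1 * nw w ∧ (qfw w - e1 * nw w = 0 → Good w) := by
  have s2 : Real.sqrt 2 * Real.sqrt 2 = 2 := Real.mul_self_sqrt (by norm_num)
  have s0 : 0 < Real.sqrt 2 := Real.sqrt_pos.mpr (by norm_num)
  have hs : 4 / 3 < Real.sqrt 2 := by nlinarith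
  have he := qfw_even (fun x t => ev (w x t)) (fun x t j => ev_even _ _)
  have ho := qfw_odd (fun x t => od (w x t)) (fun x t j => od_odd _ _)
  have n1 : 0 ≤ ∑ t, ∑ x', ∑ j, rr (dstep (fun x t => od (w x t)) t x' j)
      (dstep (fun x t => od (w x t)) t x' j) :=
    Finset.sum_nonneg fun _ _ => Finset.sum_nonneg fun _ _ => Finset.sum_nonneg fun _ _ => rr_self_nonneg _
  have n2 : 0 ≤ ∑ x, ∑ t, ∑ j, rr (danc (fun x t => od (w x t)) t x j)
      (danc (fun x t => od (w x t)) t x j) :=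
    Finset.sum_nonneg fun _ _ => Finset.sum_nonneg fun _ _ => Finset.sum_nonneg fun _ _ => rr_self_nonneg _
  have ne := nw_nonneg (fun x t => ev (w x t))
  rw [qfw_split, nw_split]
  have k1 : 0 ≤ qfw (fun x t => od (w x t)) - e1 * nw (fun x t => od (w x t)) := by
    by_contra hcon
    push Not at hcon
    have : 2 * Real.sqrt 2 * (qfw (fun x t => od (w x t)) - e1 * nw (fun x t => od (w x t))) < 0 :=
      mul_neg_of_pos_of_neg (by positivity) hcon
    linarith
  have k2 : (3 * Real.sqrt 2 - 4) * nw (fun x t => ev (w x t)) ≤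
      qfw (fun x t => ev (w x t)) - e1 * nw (fun x t => ev (w x t)) := by
    unfold e1; linarith
  have k3 : 0 ≤ (3 * Real.sqrt 2 - 4) * nw (fun x t => ev (w x t)) :=
    mul_nonneg (by linarith) ne
  refine ⟨by linarith, fun h => ?_⟩
  have h0 : nw (fun x t => ev (w x t)) = 0 := by
    have : (3 * Real.sqrt 2 - 4) * nw (fun x t => ev (w x t)) = 0 := by linarith
    rcases mul_eq_zero.mp this with h | h
    · linarith
    · exact h
  have h1 : qfw (fun x t => od (w x t)) - e1 * nw (fun x t => od (w x t)) = 0 := by linarith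
  have hw : (fun x t => od (w x t)) = w := by
    funext x t j
    have := congrFun (nw_zero h0 x t) j
    rw [← ev_add_od (w x t) j]
    simp only [Pi.zero_apply] at this
    rw [this, zero_add]
  rw [h1, mul_zero] at ho
  rw [hw] at ho n1 n2
  constructor
  · exact dzero dstep (by linarith)
  · have : ∑ x, ∑ t, ∑ j, rr (danc w t x j) (danc w t x j) = 0 := by linarith
    rw [Finset.sum_comm] at this
    exact dzero danc this

lemma nw_eq (v : G0V → ℂ) : (star v ⬝ᵥ v).re = nw (fun x t j => v (x, t, j)) := by
  simp only [dotProduct, Complex.re_sum, Pi.star_apply, star_mul_re, nw, corr, Fintype.sum_prod_type, add_zero]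

end FF

namespace FF

/-- `ω^{-j}`. -/
noncomputable def om (j : Fin 8) : ℂ := omega ^ (-(j : ℤ))

lemma om_eq (j : Fin 8) : om j = omega⁻¹ ^ (j : ℕ) := by
  rw [om, zpow_neg, zpow_natCast, inv_pow]

lemma omega_inv : omega⁻¹ = -omega ^ 3 := by
  rw [inv_eq_iff_eq_inv]
  refine eq_inv_of_mul_eq_one_left ?_
  linear_combination -omega_four

lemma om_add (i j : Fin 8) : om (i + j) = om i * om j := by
  have h8 : omega⁻¹ ^ 8 = 1 := by
    rw [inv_pow, omega_prim.pow_eq_one, inv_one]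
  rw [om_eq, om_eq, om_eq, Fin.val_add, ← pow_add, ← pow_eq_pow_mod _ h8]

lemma om_zero : om 0 = 1 := by rw [om_eq]; exact pow_zero _
lemma om_one : om 1 = -omega ^ 3 := by rw [om_eq, ← omega_inv]; exact pow_one _
lemma om_ne (j : Fin 8) : om j ≠ 0 := by rw [om_eq]; exact pow_ne_zero _ (inv_ne_zero omega_ne)

lemma om_sub (i j : Fin 8) : om (i - j) = om i * omega ^ (j : ℕ) := by
  have h := om_add (i - j) j
  rw [sub_add_cancel] at h
  rw [h, mul_assoc, om_eq j, ← mul_pow, inv_mul_cancel₀ omega_ne, one_pow, mul_one]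

lemma om_two : om 2 = -Complex.I := by
  rw [show (2 : Fin 8) = 1 + 1 by decide, om_add, om_one]
  linear_combination (omega ^ 2) * omega_four - omega_sq

lemma conj_om_one : (starRingEnd ℂ) (om 1) = omega := by
  rw [om_one, map_neg, map_pow, conj_omega]
  linear_combination (omega ^ 5 - omega) * omega_four

/-- Clock matrices. -/
noncomputable def clM (t : Fin 8) : Matrix (Fin 2) (Fin 2) ℂ := Matrix.of fun x z => clockCoef z t x

lemma clM0 (t : Fin 8) (h : t = 0 ∨ t = 2 ∨ t = 4 ∨ t = 6) : clM t = 1 := by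
  ext x z
  simp only [clM, Matrix.of_apply, clockCoef, if_pos h, Matrix.one_apply]

lemma clM1 (t : Fin 8) (h : t = 1 ∨ t = 7) : clM t = Hmat := by
  ext x z
  have h0 : ¬ (t = 0 ∨ t = 2 ∨ t = 4 ∨ t = 6) := by revert t; decide
  simp only [clM, Matrix.of_apply, clockCoef, if_pos h, if_neg h0]

lemma clM3 (t : Fin 8) (h : t = 3 ∨ t = 5) : clM t = Hmat * Tmat := by
  ext x z
  have h0 : ¬ (t = 0 ∨ t = 2 ∨ t = 4 ∨ t = 6) := by revert t; decide
  have h1 : ¬ (t = 1 ∨ t = 7) := by revert t; decide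
  simp only [clM, Matrix.of_apply, clockCoef, if_neg h1, if_neg h0]

lemma Hmat_val (a b : Fin 2) : Hmat a b = ((Real.sqrt 2 : ℝ) : ℂ) / 2 * (if a = 1 ∧ b = 1 then -1 else 1) := by
  have h := Hmat_apply a b
  have s := sqrt2_sq
  split_ifs at h ⊢ <;> linear_combination (-(Real.sqrt 2 : ℂ) / 2) * h - (Hmat a b / 2) * s

lemma HT_val (a b : Fin 2) : (Hmat * Tmat) a b = ((Real.sqrt 2 : ℝ) : ℂ) / 2 *
    (if b = 0 then 1 else if a = 0 then omega else -omega) := by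
  have h := HT_apply a b
  have s := sqrt2_sq
  split_ifs at h ⊢ <;> linear_combination (-(Real.sqrt 2 : ℂ) / 2) * h - ((Hmat * Tmat) a b / 2) * s

lemma HH : Hmat * Hmat = 1 := by
  have s := sqrt2_sq
  ext a b
  rw [Matrix.mul_apply, Fin.sum_univ_two]
  simp only [Hmat_val, Matrix.one_apply]
  fin_cases a <;> fin_cases b <;> simp <;> linear_combination (1 / 2 : ℂ) * s

lemma HTHT : (Hmat * Tmat)ᴴ * (Hmat * Tmat) = 1 := by
  have s := sqrt2_sq
  ext a b
  rw [Matrix.mul_apply, Fin.sum_univ_two]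
  simp only [Matrix.conjTranspose_apply, HT_val, Matrix.one_apply]
  fin_cases a <;> fin_cases b <;> simp [conj_omega]
  · linear_combination (1 / 2 : ℂ) * s
  · linear_combination (1 / 2 : ℂ) * s - (Real.sqrt 2 : ℂ) ^ 2 / 2 * omega_four

lemma clM_step (t : Fin 8) : clM (t + 1) = gate t * clM t := by
  match t with
  | 0 => rw [clM0 0 (by decide), clM1 (0 + 1) (by decide), mul_one]; rfl
  | 1 => rw [clM1 1 (by decide), clM0 (1 + 1) (by decide)]; exact HH.symm
  | 2 => rw [clM0 2 (by decide), clM3 (2 + 1) (by decide), mul_one]; rfl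
  | 3 => rw [clM3 3 (by decide), clM0 (3 + 1) (by decide)]; exact HTHT.symm
  | 4 => rw [clM0 4 (by decide), clM3 (4 + 1) (by decide), mul_one]; rfl
  | 5 => rw [clM3 5 (by decide), clM0 (5 + 1) (by decide)]; exact HTHT.symm
  | 6 => rw [clM0 6 (by decide), clM1 (6 + 1) (by decide), mul_one]; rfl
  | 7 => rw [clM1 7 (by decide), clM0 (7 + 1) (by decide)]; exact HH.symm

lemma psi0 (z x : Fin 2) (t j : Fin 8) : psi z 0 (x, t, j) = (1 / 8) * clM t x z * om j := by
  have h8 : ((Real.sqrt 8 : ℝ) : ℂ) ^ 2 = 8 := by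
    rw [← Complex.ofReal_pow, Real.sq_sqrt (by norm_num)]; norm_num
  have h0 : ((Real.sqrt 8 : ℝ) : ℂ) ≠ 0 := by
    intro h; rw [h] at h8; norm_num at h8
  simp only [psi, if_true, omegaVec, clM, Matrix.of_apply, om]
  push_cast
  rw [← h8]
  field_simp

lemma psi1 (z : Fin 2) (p : G0V) : psi z 1 p = (starRingEnd ℂ) (psi z 0 p) := by
  simp [psi]

lemma Good_psi0 (z : Fin 2) : Good (fun x t j => psi z 0 (x, t, j)) := by
  constructor
  · intro t x' j
    have h := congrFun (congrFun (clM_step t) x') z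
    rw [Matrix.mul_apply] at h
    simp only [dstep, psi0, om_sub, ← gate_apply]
    rw [h, Fin.sum_univ_two, Fin.sum_univ_two]
    ring
  · intro t x j
    simp only [danc, psi0, om_sub, om_add, om_one]
    have : omega ^ ((1 : Fin 8) : ℕ) = omega := pow_one _
    rw [this]
    linear_combination (-(1 / 8) * clM t x z * om j) * omega_add

lemma Good_conj {w : Fin 2 → Fin 8 → Fin 8 → ℂ} (h : Good w) :
    Good (fun x t j => (starRingEnd ℂ) (w x t j)) := by
  constructor
  · intro t x j
    have := congrArg (starRingEnd ℂ) (h.1 t x j)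
    simpa [dstep] using this
  · intro t x j
    have := congrArg (starRingEnd ℂ) (h.2 t x j)
    simpa [danc] using this

lemma Good_psi (z a : Fin 2) : Good (fun x t j => psi z a (x, t, j)) := by
  match a with
  | 0 => exact Good_psi0 z
  | 1 =>
    have := Good_conj (Good_psi0 z)
    simpa only [psi1] using this

lemma Good_add {w w' : Fin 2 → Fin 8 → Fin 8 → ℂ} (h : Good w) (h' : Good w') :
    Good (fun x t j => w x t j + w' x t j) := by
  constructor
  · intro t x j
    have a := h.1 t x j
    have b := h'.1 t x j
    simp only [dstep, Fin.sum_univ_two] at a b ⊢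
    linear_combination a + b
  · intro t x j
    have a := h.2 t x j
    have b := h'.2 t x j
    simp only [danc] at a b ⊢
    linear_combination a + b

lemma Good_smul {w : Fin 2 → Fin 8 → Fin 8 → ℂ} (c : ℂ) (h : Good w) :
    Good (fun x t j => c * w x t j) := by
  constructor
  · intro t x j
    have a := h.1 t x j
    simp only [dstep, Fin.sum_univ_two] at a ⊢
    linear_combination c * a
  · intro t x j
    have a := h.2 t x j
    simp only [danc] at a ⊢
    linear_combination c * a

lemma Good_unique {w : Fin 2 → Fin 8 → Fin 8 → ℂ} (h : Good w) (h0 : ∀ x, w x 0 0 = 0)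
    (h2 : ∀ x, w x 0 2 = 0) (x : Fin 2) (t j : Fin 8) : w x t j = 0 := by
  have base : ∀ x j, w x 0 j = 0 := by
    intro x
    have hs : ∀ a b c : Fin 8, a + 1 = c → a - 1 = b → w x 0 b = 0 → w x 0 a = 0 → w x 0 c = 0 := by
      intro a b c hc hb h1 h2
      have := h.2 0 x a
      simp only [danc, hc, hb, h1, h2] at this
      linear_combination -this
    have w0 := h0 x
    have w2 := h2 x
    have w1 : w x 0 1 = 0 := by
      have := h.2 0 x 1
      simp only [danc] at this
      rw [show (1 + 1 : Fin 8) = 2 by decide, show (1 - 1 : Fin 8) = 0 by decide, w0, w2] at this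
      have := sqrt2_ne
      simp_all
    have w3 := hs 2 1 3 (by decide) (by decide) w1 w2
    have w4 := hs 3 2 4 (by decide) (by decide) w2 w3
    have w5 := hs 4 3 5 (by decide) (by decide) w3 w4
    have w6 := hs 5 4 6 (by decide) (by decide) w4 w5
    have w7 := hs 6 5 7 (by decide) (by decide) w5 w6
    intro j
    match j with
    | 0 => exact w0
    | 1 => exact w1
    | 2 => exact w2
    | 3 => exact w3
    | 4 => exact w4
    | 5 => exact w5
    | 6 => exact w6
    | 7 => exact w7
  have step : ∀ t, (∀ x j, w x t j = 0) → ∀ x j, w x (t + 1) j = 0 := by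
    intro t ht x j
    have := h.1 t x j
    simp only [dstep, ht, Finset.sum_const_zero, add_zero] at this
    exact (mul_eq_zero.mp this).resolve_left sqrt2_ne
  have all : ∀ n : ℕ, ∀ x j, w x (Fin.ofNat 8 n) j = 0 := by
    intro n
    induction n with
    | zero => exact base
    | succ n ih =>
      have h1 : Fin.ofNat 8 (n + 1) = Fin.ofNat 8 n + 1 := by
        apply Fin.ext; simp [Fin.val_add]
      rw [h1]; exact step _ ih
  have := all t x j
  rwa [show Fin.ofNat 8 (t : ℕ) = t from Fin.ext (Nat.mod_eq_of_lt t.isLt)] at this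

/-- The sign `±1`. -/
noncomputable def sg (a : Fin 2) : ℂ := if a = 0 then 1 else -1

/-- Dual functionals. -/
noncomputable def ell (z a : Fin 2) (f : G0V → ℂ) : ℂ := 4 * (f (z, 0, 0) + sg a * Complex.I * f (z, 0, 2))

lemma conj8 : (starRingEnd ℂ) (8 : ℂ) = 8 := Complex.conj_ofNat 8

lemma psi_00 (z a x : Fin 2) : psi z a (x, 0, 0) = if x = z then 1 / 8 else 0 := by
  have h0 := psi0 z x 0 0
  rw [clM0 0 (by decide), om_zero, Matrix.one_apply] at h0
  have h1 := psi1 z (x, 0, 0)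
  rw [h0] at h1
  match a with
  | 0 => rw [h0]; split_ifs <;> simp
  | 1 => rw [h1]; split_ifs <;> simp [conj8]

lemma psi_02 (z a x : Fin 2) : psi z a (x, 0, 2) = if x = z then - sg a * Complex.I / 8 else 0 := by
  have h0 := psi0 z x 0 2
  rw [clM0 0 (by decide), om_two, Matrix.one_apply] at h0
  have h1 := psi1 z (x, 0, 2)
  rw [h0] at h1
  match a with
  | 0 => rw [h0]; split_ifs <;> simp [sg]; ring
  | 1 => rw [h1]; split_ifs <;> simp [sg, conj8]; ring

lemma expand_g0 {f : G0V → ℂ} (h : Good (fun x t j => f (x, t, j))) (p : G0V) :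
    f p = ∑ z, ∑ a, ell z a f * psi z a p := by
  obtain ⟨x, t, j⟩ := p
  have hs : Good (fun x t j => f (x, t, j) + ((-ell 0 0 f) * psi 0 0 (x, t, j) +
      ((-ell 0 1 f) * psi 0 1 (x, t, j) + ((-ell 1 0 f) * psi 1 0 (x, t, j) +
        (-ell 1 1 f) * psi 1 1 (x, t, j))))) :=
    Good_add h (Good_add (Good_smul _ (Good_psi _ _)) (Good_add (Good_smul _ (Good_psi _ _))
      (Good_add (Good_smul _ (Good_psi _ _)) (Good_smul _ (Good_psi _ _)))))
  have hu := Good_unique hs ?_ ?_ x t j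
  · simp only [Fin.sum_univ_two]
    linear_combination hu
  · intro x
    simp only [psi_00, ell, sg]
    fin_cases x <;> simp <;> ring
  · intro x
    simp only [psi_02, ell, sg]
    have hI := Complex.I_sq
    fin_cases x <;> simp
    · linear_combination f (0, 0, 2) * hI
    · linear_combination f (1, 0, 2) * hI

lemma ell_sum (z a : Fin 2) {ι : Type*} (s : Finset ι) (f : ι → G0V → ℂ) (c : ι → ℂ) :
    ell z a (fun p => ∑ i ∈ s, f i p * c i) = ∑ i ∈ s, ell z a (f i) * c i := by
  simp only [ell, Finset.mul_sum, ← Finset.sum_add_distrib]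
  refine Finset.sum_congr rfl fun i _ => by ring

lemma two_particle (F : G0V → G0V → ℂ) (hsym : ∀ u v, F u v = F v u) (hd : ∀ u, F u u = 0)
    (hg : ∀ v, Good (fun x t j => F (x, t, j) v)) (u v : G0V) : F u v = 0 := by
  set K : Fin 2 → Fin 2 → Fin 2 → Fin 2 → ℂ := fun z a z' a' =>
    ell z a (fun u => ell z' a' (fun v => F u v)) with hK
  have Ksym : ∀ z a z' a', K z a z' a' = K z' a' z a := by
    intro z a z' a'
    simp only [hK, ell]
    rw [hsym (z', 0, 0) (z, 0, 0), hsym (z', 0, 0) (z, 0, 2), hsym (z', 0, 2) (z, 0, 0),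
      hsym (z', 0, 2) (z, 0, 2)]
    ring
  have hexp : ∀ u v, F u v = ∑ z, ∑ a, ∑ z', ∑ a', K z a z' a' * psi z a u * psi z' a' v := by
    intro u v
    have h1 : F u v = ∑ z, ∑ a, ell z a (fun u => F u v) * psi z a u :=
      expand_g0 (f := fun u => F u v) (hg v) u
    have h2 : ∀ u, F u v = ∑ z', ∑ a', ell z' a' (fun v => F u v) * psi z' a' v := by
      intro u
      have : (fun v => F u v) = fun v => F v u := by funext v; exact hsym u v
      rw [this, ← expand_g0 (f := fun v => F v u) (hg u) v]
      exact hsym u v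
    rw [h1]
    refine Finset.sum_congr rfl fun z _ => Finset.sum_congr rfl fun a _ => ?_
    have h3 : ell z a (fun u => F u v) = ∑ z', ∑ a', K z a z' a' * psi z' a' v := by
      simp only [ell, h2 (z, 0, 0), h2 (z, 0, 2), hK, Fin.sum_univ_two]
      ring
    rw [h3]
    simp only [Finset.sum_mul]
    refine Finset.sum_congr rfl fun z' _ => Finset.sum_congr rfl fun a' _ => by ring
  have hI := Complex.I_sq
  have key : ∀ x t,
      (∑ z, ∑ z', K z 0 z' 0 * clM t x z * clM t x z' = 0) ∧
      (∑ z, ∑ z', K z 0 z' 1 * clM t x z * (starRingEnd ℂ) (clM t x z') = 0) ∧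
      (∑ z, ∑ z', K z 1 z' 1 * (starRingEnd ℂ) (clM t x z) * (starRingEnd ℂ) (clM t x z') = 0) := by
    intro x t
    have hj : ∀ j, (∑ z, ∑ z', K z 0 z' 0 * clM t x z * clM t x z') * om j ^ 2 +
        2 * (∑ z, ∑ z', K z 0 z' 1 * clM t x z * (starRingEnd ℂ) (clM t x z')) *
          (om j * (starRingEnd ℂ) (om j)) +
        (∑ z, ∑ z', K z 1 z' 1 * (starRingEnd ℂ) (clM t x z) * (starRingEnd ℂ) (clM t x z')) *
          (starRingEnd ℂ) (om j) ^ 2 = 0 := by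
      intro j
      have := hd (x, t, j)
      rw [hexp] at this
      have c8 : (starRingEnd ℂ) (1 / 8 : ℂ) = 1 / 8 := by simp [conj8]
      simp only [Fin.sum_univ_two, psi1, psi0, map_mul, c8] at this ⊢
      rw [Ksym 0 1 0 0, Ksym 0 1 1 0, Ksym 1 1 0 0, Ksym 1 1 1 0] at this
      linear_combination 64 * this
    have j0 := hj 0
    have j1 := hj 1
    have j2 := hj 2
    rw [om_zero, map_one] at j0
    rw [om_two, map_neg, Complex.conj_I] at j2
    rw [conj_om_one] at j1
    have o1 : om 1 ^ 2 = -Complex.I := by rw [← om_two, show (2 : Fin 8) = 1 + 1 by decide, om_add]; ring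
    have o2 : om 1 * omega = 1 := by
      rw [om_one]; linear_combination -omega_four
    rw [o1, o2, omega_sq] at j1
    set X := ∑ z, ∑ z', K z 0 z' 0 * clM t x z * clM t x z'
    set Y := ∑ z, ∑ z', K z 0 z' 1 * clM t x z * (starRingEnd ℂ) (clM t x z')
    set W := ∑ z, ∑ z', K z 1 z' 1 * (starRingEnd ℂ) (clM t x z) * (starRingEnd ℂ) (clM t x z')
    have hY : Y = 0 := by
      linear_combination (1 / 4) * j0 + (1 / 4) * j2 + (-1 / 4 * X + 1 / 2 * Y - 1 / 4 * W) * hI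
    have hXW : X + W = 0 := by linear_combination j0 - 2 * hY
    have hXW' : X - W = 0 := by
      linear_combination Complex.I * j1 - 2 * Complex.I * hY + (X - W) * hI
    refine ⟨?_, hY, ?_⟩
    · linear_combination (1 / 2) * hXW + (1 / 2) * hXW'
    · linear_combination (1 / 2) * hXW - (1 / 2) * hXW'
  have s := sqrt2_sq
  have z0 := fun x => key x 0
  have z1 := key 0 1
  have z3 := key 0 3
  rw [clM0 0 (by decide)] at z0
  rw [clM1 1 (by decide)] at z1
  rw [clM3 3 (by decide)] at z3
  have H0 : ∀ z, Hmat 0 z = ((Real.sqrt 2 : ℝ) : ℂ) / 2 := by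
    intro z; rw [Hmat_val]; simp
  have HT0 : (Hmat * Tmat) 0 0 = ((Real.sqrt 2 : ℝ) : ℂ) / 2 := by rw [HT_val]; simp
  have HT1 : (Hmat * Tmat) 0 1 = ((Real.sqrt 2 : ℝ) : ℂ) / 2 * omega := by rw [HT_val]; simp
  have cs : (starRingEnd ℂ) (((Real.sqrt 2 : ℝ) : ℂ) / 2) = ((Real.sqrt 2 : ℝ) : ℂ) / 2 := by
    rw [map_div₀, Complex.conj_ofReal, Complex.conj_ofNat]
  simp only [Fin.sum_univ_two, H0, HT0, HT1, map_mul, cs, conj_omega] at z1 z3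
  have z00 := z0 0
  have z01 := z0 1
  simp only [Fin.sum_univ_two, Matrix.one_apply] at z00 z01
  simp at z00 z01
  have e1 : K 0 0 1 0 = 0 := by
    have := z1.1
    have k := Ksym 1 0 0 0
    rw [z00.1, z01.1, k] at this
    linear_combination this - (K 0 0 1 0 / 2) * s
  have e2 : K 0 1 1 1 = 0 := by
    have := z1.2.2
    have k := Ksym 1 1 0 1
    rw [z00.2.2, z01.2.2, k] at this
    linear_combination this - (K 0 1 1 1 / 2) * s
  have e3 : K 0 0 1 1 + K 1 0 0 1 = 0 := by
    have := z1.2.1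
    rw [z00.2.1, z01.2.1] at this
    linear_combination 2 * this - ((K 0 0 1 1 + K 1 0 0 1) / 2) * s
  have e4 : - K 0 0 1 1 * omega ^ 3 + K 1 0 0 1 * omega = 0 := by
    have := z3.2.1
    rw [z00.2.1, z01.2.1] at this
    linear_combination 2 * this - ((- K 0 0 1 1 * omega ^ 3 + K 1 0 0 1 * omega) / 2) * s
  have e5 : K 0 0 1 1 = 0 := by
    have h : K 0 0 1 1 * (omega * (Complex.I + 1)) = 0 := by
      rw [← omega_sq]
      linear_combination omega * e3 - e4
    rcases mul_eq_zero.mp h with h | h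
    · exact h
    · exfalso
      rcases mul_eq_zero.mp h with h | h
      · exact omega_ne h
      · have := congrArg Complex.re h
        norm_num at this
  have e6 : K 1 0 0 1 = 0 := by linear_combination e3 - e5
  have allK : ∀ z a z' a', K z a z' a' = 0 := by
    intro z a z' a'
    match z, a, z', a' with
    | 0, 0, 0, 0 => exact z00.1
    | 0, 0, 0, 1 => exact z00.2.1
    | 0, 0, 1, 0 => exact e1
    | 0, 0, 1, 1 => exact e5
    | 0, 1, 0, 0 => exact (Ksym 0 1 0 0).trans z00.2.1
    | 0, 1, 0, 1 => exact z00.2.2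
    | 0, 1, 1, 0 => exact (Ksym 0 1 1 0).trans e6
    | 0, 1, 1, 1 => exact e2
    | 1, 0, 0, 0 => exact (Ksym 1 0 0 0).trans e1
    | 1, 0, 0, 1 => exact e6
    | 1, 0, 1, 0 => exact z01.1
    | 1, 0, 1, 1 => exact z01.2.1
    | 1, 1, 0, 0 => exact (Ksym 1 1 0 0).trans e5
    | 1, 1, 0, 1 => exact (Ksym 1 1 0 1).trans e2
    | 1, 1, 1, 0 => exact (Ksym 1 1 1 0).trans z01.2.1
    | 1, 1, 1, 1 => exact z01.2.2
  rw [hexp]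
  simp [allK]

end FF

namespace FF

lemma sumGGV {R : ℕ} {M : Type*} [AddCommMonoid M] (g : GGV R → M) :
    ∑ p, g p = ∑ q : Fin R, ∑ u : G0V, g ((q, u.1, u.2.1), u.2.2) := by
  simp only [Fintype.sum_prod_type]

/-- block part -/
noncomputable def blk (R : ℕ) : Matrix (GGV R) (GGV R) ℂ := Matrix.of fun p q : GGV R =>
    if p.1.1 = q.1.1 then Ag0 (p.1.2.1, p.1.2.2, p.2) (q.1.2.1, q.1.2.2, q.2) else 0

/-- The restriction to a diagram element. -/
def sl {R : ℕ} (f : GGV R → ℂ) (q : Fin R) : G0V → ℂ := fun u => f ((q, u.1, u.2.1), u.2.2)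

lemma blk_form {R : ℕ} (f : GGV R → ℂ) :
    star f ⬝ᵥ (blk R *ᵥ f) = ∑ q, star (sl f q) ⬝ᵥ (Ag0 *ᵥ sl f q) := by
  simp only [dotProduct, Matrix.mulVec]
  rw [sumGGV]
  refine Finset.sum_congr rfl fun q _ => Finset.sum_congr rfl fun u _ => ?_
  rw [sumGGV]
  congr 1
  rw [Finset.sum_eq_single q]
  · simp [blk, sl]
  · intro b _ hb
    refine Finset.sum_eq_zero fun v _ => ?_
    simp [blk, Ne.symm hb]
  · simp

lemma one_form {R : ℕ} (f : GGV R → ℂ) :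
    star f ⬝ᵥ f = ∑ q, star (sl f q) ⬝ᵥ (sl f q) := by
  simp only [dotProduct]
  rw [sumGGV]
  rfl

lemma hS_mulVec {R : ℕ} (S : Finset (GNode R)) (f : GGV R → ℂ) (p : GGV R) :
    (hS S *ᵥ f) p = if p.1 ∈ S then f p else 0 := by
  simp only [Matrix.mulVec, dotProduct]
  rw [Finset.sum_eq_single p]
  · simp [hS]
  · intro b _ hb
    have : ¬ (p.1 = b.1 ∧ p.1 ∈ S ∧ p.2 = b.2) := fun h => hb (Prod.ext h.1.symm h.2.2.symm)
    simp [hS, this]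
  · simp

lemma hS_form {R : ℕ} (S : Finset (GNode R)) (f : GGV R → ℂ) :
    0 ≤ (star f ⬝ᵥ (hS S *ᵥ f)).re := by
  simp only [dotProduct, hS_mulVec, Complex.re_sum]
  refine Finset.sum_nonneg fun p _ => ?_
  split_ifs
  · rw [Pi.star_apply, star_mul_re]; exact rr_self_nonneg _
  · simp

lemma edge_mulVec {R : ℕ} (u v : GNode R) (f : GGV R → ℂ) (p : GGV R) :
    (edgeTerm u v *ᵥ f) p = ((if p.1 = u then (1 : ℂ) else 0) + (if p.1 = v then (1 : ℂ) else 0)) *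
      (f (u, p.2) + f (v, p.2)) := by
  simp only [Matrix.mulVec, dotProduct, edgeTerm, Matrix.of_apply]
  rw [Fintype.sum_prod_type_right, Finset.sum_eq_single p.2]
  · simp [mul_add, add_mul, Finset.sum_add_distrib, ite_and]
  · intro b _ hb
    simp [Ne.symm hb]
  · simp

lemma edge_form {R : ℕ} (u v : GNode R) (f : GGV R → ℂ) :
    0 ≤ (star f ⬝ᵥ (edgeTerm u v *ᵥ f)).re := by
  have : star f ⬝ᵥ (edgeTerm u v *ᵥ f) =
      ∑ j, star (f (u, j) + f (v, j)) * (f (u, j) + f (v, j)) := by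
    simp only [dotProduct, edge_mulVec]
    rw [Fintype.sum_prod_type_right]
    refine Finset.sum_congr rfl fun j _ => ?_
    simp [add_mul, mul_add, Finset.sum_add_distrib]
  rw [this, Complex.re_sum]
  refine Finset.sum_nonneg fun p _ => ?_
  rw [star_mul_re]; exact rr_self_nonneg _

lemma hE_form {R : ℕ} (E : Finset (Sym2 (GNode R))) (f : GGV R → ℂ) :
    0 ≤ (star f ⬝ᵥ (hE E *ᵥ f)).re := by
  rw [hE, Matrix.sum_mulVec, dotProduct_sum, Complex.re_sum]
  refine Finset.sum_nonneg fun e _ => ?_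
  induction e with
  | _ u v => exact edge_form u v f

lemma edge_herm {R : ℕ} (u v : GNode R) : (edgeTerm u v)ᴴ = edgeTerm u v := by
  ext p q
  simp only [Matrix.conjTranspose_apply, edgeTerm, Matrix.of_apply, @eq_comm _ q.2 p.2]
  split_ifs <;> simp

lemma hS_herm {R : ℕ} (S : Finset (GNode R)) : (hS S)ᴴ = hS S := by
  ext p q
  simp only [Matrix.conjTranspose_apply, hS, Matrix.of_apply]
  by_cases h : p = q
  · subst h; split_ifs <;> simp
  · have h1 : ¬ (p.1 = q.1 ∧ p.1 ∈ S ∧ p.2 = q.2) := fun h' => h (Prod.ext h'.1 h'.2.2)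
    have h2 : ¬ (q.1 = p.1 ∧ q.1 ∈ S ∧ q.2 = p.2) := fun h' => h (Prod.ext h'.1 h'.2.2).symm
    simp [h1, h2]

lemma hE_herm {R : ℕ} (E : Finset (Sym2 (GNode R))) : (hE E)ᴴ = hE E := by
  rw [hE, Matrix.conjTranspose_sum]
  refine Finset.sum_congr rfl fun e _ => ?_
  induction e with
  | _ u v => exact edge_herm u v

lemma blk_herm (R : ℕ) : (blk R)ᴴ = blk R := by
  ext p q
  simp only [Matrix.conjTranspose_apply, blk, Matrix.of_apply, @eq_comm _ q.1.1 p.1.1]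
  split_ifs
  · exact congrFun (congrFun Ag0_herm _) _
  · simp

lemma AG_eq {R : ℕ} (S : Finset (GNode R)) (E : Finset (Sym2 (GNode R))) :
    AG S E = blk R + hS S + hE E := rfl

lemma AG_herm {R : ℕ} (S : Finset (GNode R)) (E : Finset (Sym2 (GNode R))) :
    (AG S E - (e1 : ℂ) • 1)ᴴ = AG S E - (e1 : ℂ) • 1 := by
  rw [AG_eq, Matrix.conjTranspose_sub, Matrix.conjTranspose_add, Matrix.conjTranspose_add,
    blk_herm, hS_herm, hE_herm, Matrix.conjTranspose_smul, Matrix.conjTranspose_one]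
  simp

lemma AG_form {R : ℕ} (S : Finset (GNode R)) (E : Finset (Sym2 (GNode R))) (f : GGV R → ℂ) :
    0 ≤ (star f ⬝ᵥ ((AG S E - (e1 : ℂ) • 1) *ᵥ f)).re ∧
    ((star f ⬝ᵥ ((AG S E - (e1 : ℂ) • 1) *ᵥ f)).re = 0 →
      ∀ q, Good (fun x t j => f ((q, x, t), j))) := by
  have hb : (star f ⬝ᵥ ((AG S E - (e1 : ℂ) • 1) *ᵥ f)).re =
      ∑ q, (qfw (fun x t j => f ((q, x, t), j)) - e1 * nw (fun x t j => f ((q, x, t), j)))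
        + (star f ⬝ᵥ (hS S *ᵥ f)).re + (star f ⬝ᵥ (hE E *ᵥ f)).re := by
    rw [AG_eq, Matrix.sub_mulVec, Matrix.add_mulVec, Matrix.add_mulVec, Matrix.smul_mulVec,
      Matrix.one_mulVec, dotProduct_sub, dotProduct_add, dotProduct_add, dotProduct_smul,
      blk_form, one_form, Complex.sub_re, Complex.add_re, Complex.add_re, smul_eq_mul,
      Complex.re_ofReal_mul, Complex.re_sum, Complex.re_sum, Finset.sum_sub_distrib,
      ← Finset.mul_sum]
    simp only [qf_eq, nw_eq, sl]
    ring
  have m := fun q => main_g0 (fun x t j => f ((q, x, t), j))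
  have s0 := hS_form S f
  have s1 := hE_form E f
  have s2 := Finset.sum_nonneg (fun q (_ : q ∈ Finset.univ) => (m q).1)
  rw [hb]
  refine ⟨by linarith, fun h q => (m q).2 ?_⟩
  have h0 := le_antisymm (by linarith) s2
  exact (Finset.sum_eq_zero_iff_of_nonneg (fun q _ => (m q).1)).mp h0 q (Finset.mem_univ q)

section
open scoped ComplexOrder

lemma AG_psd {R : ℕ} (S : Finset (GNode R)) (E : Finset (Sym2 (GNode R))) :
    (AG S E - (e1 : ℂ) • 1).PosSemidef := by
  refine Matrix.PosSemidef.of_dotProduct_mulVec_nonneg (AG_herm S E) fun f => ?_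
  rw [Complex.le_def]
  refine ⟨(AG_form S E f).1, ?_⟩
  have h : star (star f ⬝ᵥ ((AG S E - (e1 : ℂ) • 1) *ᵥ f)) =
      star f ⬝ᵥ ((AG S E - (e1 : ℂ) • 1) *ᵥ f) := by
    rw [← Matrix.star_dotProduct_star, star_star, Matrix.star_mulVec, AG_herm, ← Matrix.dotProduct_mulVec]
  have := congrArg Complex.im h
  simp at this
  simp; linarith

lemma AG_zero {R : ℕ} (S : Finset (GNode R)) (E : Finset (Sym2 (GNode R))) (f : GGV R → ℂ)
    (h : (star f ⬝ᵥ ((AG S E - (e1 : ℂ) • 1) *ᵥ f)).re = 0) :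
    (AG S E - (e1 : ℂ) • 1) *ᵥ f = 0 := by
  rw [← (AG_psd S E).dotProduct_mulVec_zero_iff]
  have := (AG_psd S E).dotProduct_mulVec_nonneg f
  rw [Complex.le_def] at this
  exact Complex.ext h this.2.symm

end

end FF

namespace FF

section generic
variable {V : Type*} [Fintype V] [DecidableEq V] {N : ℕ}

/-- One-particle slice of an `N`-particle state. -/
def slice (Γ : (Fin N → V) → ℂ) (w : Fin N) (x : Fin N → V) : V → ℂ :=
  fun v => Γ (Function.update x w v)

lemma onFactor_mulVec (M : Matrix V V ℂ) (w : Fin N) (Γ : (Fin N → V) → ℂ) (x : Fin N → V) :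
    (BH.onFactor N M w *ᵥ Γ) x = (M *ᵥ slice Γ w x) (x w) := by
  simp only [Matrix.mulVec, dotProduct, BH.onFactor, Matrix.of_apply]
  symm
  refine Fintype.sum_of_injective (fun v => Function.update x w v)
    (Function.update_injective x w) _ _ ?_ ?_
  · intro y hy
    have : ¬ ∀ u, u ≠ w → x u = y u := by
      intro h
      refine hy ⟨y w, ?_⟩
      funext u
      by_cases hu : u = w
      · subst hu; simp
      · simp [hu, h u hu]
    simp [this]
  · intro v
    have : ∀ u, u ≠ w → x u = Function.update x w v u := by
      intro u hu; simp [hu]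
    rw [if_pos this]
    simp [slice]

lemma slice_update (Γ : (Fin N → V) → ℂ) (w : Fin N) (x : Fin N → V) (v : V) :
    slice Γ w (Function.update x w v) = slice Γ w x := by
  funext u; simp [slice]

lemma sum_flip (w : Fin N) (G : (Fin N → V) → V → ℂ) :
    ∑ x, ∑ v, G x v = ∑ x : Fin N → V, ∑ v, G (Function.update x w v) (x w) := by
  rw [← Fintype.sum_prod_type', ← Fintype.sum_prod_type'
    (f := fun (x : Fin N → V) v => G (Function.update x w v) (x w))]
  have hinv : Function.Involutive
      (fun p : (Fin N → V) × V => (Function.update p.1 w p.2, p.1 w)) := by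
    intro p
    simp
  exact (Equiv.sum_comp hinv.toPerm (fun p : (Fin N → V) × V => G p.1 p.2)).symm

lemma form_slices (M : Matrix V V ℂ) (w : Fin N) (Γ : (Fin N → V) → ℂ) :
    (Fintype.card V : ℝ) * (star Γ ⬝ᵥ (BH.onFactor N M w *ᵥ Γ)).re =
      ∑ x, (star (slice Γ w x) ⬝ᵥ (M *ᵥ slice Γ w x)).re := by
  rw [← Complex.re_sum]
  have h : ∑ x, star (slice Γ w x) ⬝ᵥ (M *ᵥ slice Γ w x) =
      (Fintype.card V : ℂ) * (star Γ ⬝ᵥ (BH.onFactor N M w *ᵥ Γ)) := by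
    simp only [dotProduct]
    rw [sum_flip w, Finset.mul_sum]
    refine Finset.sum_congr rfl fun x _ => ?_
    simp only [slice_update, onFactor_mulVec, Pi.star_apply]
    simp [slice]
  rw [h]
  rw [show (Fintype.card V : ℂ) = ((Fintype.card V : ℝ) : ℂ) by push_cast; rfl,
    Complex.re_ofReal_mul]

/-- number of coinciding ordered pairs -/
def npair (x : Fin N → V) : ℕ := ((Finset.univ : Finset (Fin N × Fin N)).filter
          fun p => p.1 ≠ p.2 ∧ x p.1 = x p.2).card

lemma interaction_mulVec (Γ : (Fin N → V) → ℂ) (x : Fin N → V) :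
    (BH.interaction V N *ᵥ Γ) x = (npair x : ℂ) * Γ x := by
  simp only [Matrix.mulVec, dotProduct, BH.interaction, Matrix.of_apply, npair]
  simp

lemma onFactor_sub (A : Matrix V V ℂ) (e : ℂ) (w : Fin N) (Γ : (Fin N → V) → ℂ) (x : Fin N → V) :
    (BH.onFactor N (A - e • 1) w *ᵥ Γ) x = (BH.onFactor N A w *ᵥ Γ) x - e * Γ x := by
  rw [onFactor_mulVec, onFactor_mulVec, Matrix.sub_mulVec, Matrix.smul_mulVec, Matrix.one_mulVec]
  simp [slice]

lemma ham_iff (A : Matrix V V ℂ) (e : ℂ) (Γ : (Fin N → V) → ℂ) :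
    (BH.bhHam A N *ᵥ Γ = ((N : ℂ) * e) • Γ) ↔
    (∑ w, BH.onFactor N (A - e • 1) w *ᵥ Γ) + BH.interaction V N *ᵥ Γ = 0 := by
  rw [BH.bhHam, Matrix.add_mulVec, Matrix.sum_mulVec]
  have : (∑ w, BH.onFactor N (A - e • 1) w *ᵥ Γ) =
      (∑ w, BH.onFactor N A w *ᵥ Γ) - ((N : ℂ) * e) • Γ := by
    funext x
    simp only [Finset.sum_apply, onFactor_sub, Finset.sum_sub_distrib, Pi.sub_apply, Pi.smul_apply,
      smul_eq_mul]
    simp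
    ring
  rw [this, sub_add_eq_add_sub, sub_eq_zero]

lemma ground [Nonempty V] (A : Matrix V V ℂ) (e : ℂ) (Γ : (Fin N → V) → ℂ)
    (hpos : ∀ f : V → ℂ, 0 ≤ (star f ⬝ᵥ ((A - e • 1) *ᵥ f)).re)
    (h : BH.bhHam A N *ᵥ Γ = ((N : ℂ) * e) • Γ) :
    (∀ w x, (star (slice Γ w x) ⬝ᵥ ((A - e • 1) *ᵥ slice Γ w x)).re = 0) ∧
    (∀ x w w', w ≠ w' → x w = x w' → Γ x = 0) := by
  rw [ham_iff] at h
  have h1 := congrArg (fun v => (star Γ ⬝ᵥ v).re) h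
  simp only [dotProduct_add, dotProduct_sum, Complex.add_re, Complex.re_sum, dotProduct_zero,
    Complex.zero_re] at h1
  have hc : (0 : ℝ) < Fintype.card V := by exact_mod_cast Fintype.card_pos
  have hw : ∀ w, 0 ≤ (star Γ ⬝ᵥ (BH.onFactor N (A - e • 1) w *ᵥ Γ)).re := by
    intro w
    have := form_slices (A - e • 1) w Γ
    have h2 : 0 ≤ ∑ x, (star (slice Γ w x) ⬝ᵥ ((A - e • 1) *ᵥ slice Γ w x)).re :=
      Finset.sum_nonneg fun x _ => hpos _
    rw [← this] at h2
    exact nonneg_of_mul_nonneg_right h2 hc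
  have hi : (star Γ ⬝ᵥ (BH.interaction V N *ᵥ Γ)).re = ∑ x, (npair x : ℝ) * rr (Γ x) (Γ x) := by
    simp only [dotProduct, interaction_mulVec, Complex.re_sum]
    refine Finset.sum_congr rfl fun x _ => ?_
    rw [← star_mul_re, ← Complex.re_ofReal_mul, Pi.star_apply]
    push_cast
    congr 1
    ring
  have hi0 : ∀ x : Fin N → V, 0 ≤ (npair x : ℝ) * rr (Γ x) (Γ x) := fun x =>
    mul_nonneg (Nat.cast_nonneg _) (rr_self_nonneg _)
  have s1 := Finset.sum_nonneg (fun w (_ : w ∈ Finset.univ) => hw w)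
  have s2 := Finset.sum_nonneg (fun x (_ : x ∈ Finset.univ) => hi0 x)
  rw [hi] at h1
  have z1 := le_antisymm (by linarith) s1
  have z2 := le_antisymm (by linarith) s2
  rw [Finset.sum_eq_zero_iff_of_nonneg (fun w _ => hw w)] at z1
  rw [Finset.sum_eq_zero_iff_of_nonneg (fun w _ => hi0 w)] at z2
  constructor
  · intro w x
    have := form_slices (A - e • 1) w Γ
    rw [z1 w (Finset.mem_univ _), mul_zero] at this
    exact (Finset.sum_eq_zero_iff_of_nonneg (fun x _ => hpos _)).mp this.symm x (Finset.mem_univ x)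
  · intro x w w' hne hx
    rcases mul_eq_zero.mp (z2 x (Finset.mem_univ x)) with h0 | h0
    · exfalso
      rw [Nat.cast_eq_zero, npair, Finset.card_eq_zero] at h0
      have : (w, w') ∈ (Finset.univ : Finset (Fin N × Fin N)).filter
          fun p => p.1 ≠ p.2 ∧ x p.1 = x p.2 := by simp [hne, hx]
      rw [h0] at this
      simp at this
    · exact rr_self_eq_zero h0

lemma backward (A : Matrix V V ℂ) (e : ℂ) (Γ : (Fin N → V) → ℂ)
    (h1 : ∀ w : Fin N, BH.onFactor N (A - e • 1) w *ᵥ Γ = 0)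
    (h2 : ∀ x w w', w ≠ w' → x w = x w' → Γ x = 0) :
    BH.bhHam A N *ᵥ Γ = ((N : ℂ) * e) • Γ := by
  rw [ham_iff]
  simp only [h1, Finset.sum_const_zero, zero_add]
  funext x
  rw [interaction_mulVec]
  by_cases h : npair x = 0
  · simp [h]
  · rw [npair, Finset.card_eq_zero, ← ne_eq, ← Finset.nonempty_iff_ne_empty] at h
    obtain ⟨p, hp⟩ := h
    simp only [Finset.mem_filter, Finset.mem_univ, true_and] at hp
    rw [h2 x p.1 p.2 hp.1 hp.2]
    simp

lemma kernel_expand {C : Type*} [Fintype C] [DecidableEq C] (Ψ L : C → V → ℂ) (Γ : (Fin N → V) → ℂ)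
    (h : ∀ w x, Γ x = ∑ u, (∑ c, Ψ c (x w) * L c u) * Γ (Function.update x w u)) (x : Fin N → V) :
    Γ x = ∑ c : Fin N → C, (∑ y, (∏ w, L (c w) (y w)) * Γ y) * ∏ w, Ψ (c w) (x w) := by
  have ind : ∀ s : Finset (Fin N), ∀ x, Γ x = ∑ y : Fin N → V,
      (∏ w, if w ∈ s then ∑ c, Ψ c (x w) * L c (y w) else if x w = y w then 1 else 0) * Γ y := by
    intro s
    induction s using Finset.induction_on with
    | empty =>
      intro x
      rw [Finset.sum_eq_single x]
      · simp
      · intro y _ hy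
        obtain ⟨w, hw⟩ := Function.ne_iff.mp hy
        rw [Finset.prod_eq_zero (Finset.mem_univ w), zero_mul]
        simp [Ne.symm hw]
      · simp
    | insert w0 s hw0 ih =>
      intro x
      rw [h w0 x]
      simp_rw [fun u => ih (Function.update x w0 u)]
      simp_rw [Finset.mul_sum]
      rw [Finset.sum_comm]
      refine Finset.sum_congr rfl fun y _ => ?_
      rw [Finset.sum_eq_single (y w0)]
      · rw [← mul_assoc]
        congr 1
        rw [← Finset.mul_prod_erase _ _ (Finset.mem_univ w0),
          ← Finset.mul_prod_erase (Finset.univ : Finset (Fin N)) (fun w => if w ∈ insert w0 s then ∑ c, Ψ c (x w) * L c (y w) else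
            if x w = y w then 1 else 0) (Finset.mem_univ w0)]
        rw [if_neg hw0, if_pos (Finset.mem_insert_self _ _)]
        simp only [Function.update_self, if_true, one_mul]
        congr 1
        refine Finset.prod_congr rfl fun w hw => ?_
        have hne := Finset.ne_of_mem_erase hw
        simp [hne, Finset.mem_insert]
      · intro u _ hu
        have : (∏ w, if w ∈ s then ∑ c, Ψ c (Function.update x w0 u w) * L c (y w) else
            if Function.update x w0 u w = y w then (1 : ℂ) else 0) = 0 := by
          refine Finset.prod_eq_zero (Finset.mem_univ w0) ?_
          simp [hw0, hu]
        rw [this]; ring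
      · simp
  rw [ind Finset.univ x]
  simp only [Finset.mem_univ, if_true, Finset.prod_univ_sum, Fintype.piFinset_univ,
    Finset.prod_mul_distrib, Finset.sum_mul]
  rw [Finset.sum_comm]
  refine Finset.sum_congr rfl fun c _ => Finset.sum_congr rfl fun y _ => by ring

lemma symm_expand {C : Type*} [Fintype C] [DecidableEq C] (Ψ : C → V → ℂ) (Γ : (Fin N → V) → ℂ)
    (hΓ : Γ ∈ BH.symmStates V N) (coef : (Fin N → C) → ℂ)
    (h : ∀ x, Γ x = ∑ c : Fin N → C, coef c * ∏ w, Ψ (c w) (x w)) :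
    Γ = ∑ c : Fin N → C, (coef c * ((Real.sqrt (N.factorial) : ℝ) : ℂ) / (N.factorial : ℂ)) •
      symSt N (fun w => Ψ (c w)) := by
  have hf : (N.factorial : ℂ) ≠ 0 := by exact_mod_cast N.factorial_ne_zero
  have hs : ((Real.sqrt (N.factorial) : ℝ) : ℂ) ≠ 0 := by
    rw [Complex.ofReal_ne_zero]
    exact (Real.sqrt_pos.mpr (by exact_mod_cast N.factorial_pos)).ne'
  funext x
  have h1 : (N.factorial : ℂ) * Γ x = ∑ σ : Equiv.Perm (Fin N), Γ (x ∘ σ) := by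
    rw [Finset.sum_congr rfl fun σ _ => hΓ σ x]
    simp [Fintype.card_perm]
  have h2 : ∑ σ : Equiv.Perm (Fin N), Γ (x ∘ σ) =
      ∑ c : Fin N → C, coef c * ∑ σ : Equiv.Perm (Fin N), ∏ w, Ψ (c (σ w)) (x w) := by
    simp_rw [h, Finset.mul_sum]
    rw [Finset.sum_comm]
    refine Finset.sum_congr rfl fun c _ => ?_
    rw [← Equiv.sum_comp (Equiv.inv (Equiv.Perm (Fin N)))]
    refine Finset.sum_congr rfl fun σ _ => ?_
    congr 1
    rw [← Equiv.prod_comp σ]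
    refine Finset.prod_congr rfl fun w _ => ?_
    simp
  rw [h2] at h1
  have h3 : Γ x = (N.factorial : ℂ)⁻¹ *
      ∑ c : Fin N → C, coef c * ∑ σ : Equiv.Perm (Fin N), ∏ w, Ψ (c (σ w)) (x w) := by
    rw [← h1]; field_simp
  rw [h3, Finset.sum_apply, Finset.mul_sum]
  refine Finset.sum_congr rfl fun c _ => ?_
  simp only [Pi.smul_apply, smul_eq_mul, symSt]
  push_cast
  field_simp

end generic

end FF

namespace FF

/-- Embedding of `g₀` in the gate graph. -/
def emb {R : ℕ} (q : Fin R) (u : G0V) : GGV R := ((q, u.1, u.2.1), u.2.2)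

lemma emb_surj {R : ℕ} (p : GGV R) : emb p.1.1 (p.1.2.1, p.1.2.2, p.2) = p := rfl

/-- Dual kernel. -/
noncomputable def Lk {R : ℕ} (c : Fin R × Fin 2 × Fin 2) (u : GGV R) : ℂ :=
  (if u = ((c.1, c.2.1, 0), 0) then 4 else 0) +
    (if u = ((c.1, c.2.1, 0), 2) then 4 * sg c.2.2 * Complex.I else 0)

lemma Lk_supp {R : ℕ} (c : Fin R × Fin 2 × Fin 2) (u : GGV R) (h : u.1.1 ≠ c.1) : Lk c u = 0 := by
  have h1 : u ≠ ((c.1, c.2.1, 0), 0) := by rintro rfl; exact h rfl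
  have h2 : u ≠ ((c.1, c.2.1, 0), 2) := by rintro rfl; exact h rfl
  simp [Lk, h1, h2]

lemma Lk_sum {R : ℕ} (c : Fin R × Fin 2 × Fin 2) (f : GGV R → ℂ) :
    ∑ u, Lk c u * f u = ell c.2.1 c.2.2 (fun v => f (emb c.1 v)) := by
  simp only [Lk, add_mul, ite_mul, zero_mul, Finset.sum_add_distrib, Finset.sum_ite_eq',
    Finset.mem_univ, if_true, ell, emb]
  ring

lemma slice_expand {R : ℕ} (f : GGV R → ℂ) (h : ∀ q, Good (fun x t j => f ((q, x, t), j)))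
    (p : GGV R) : f p = ∑ u, (∑ c : Fin R × Fin 2 × Fin 2, psiQ c.1 c.2.1 c.2.2 p * Lk c u) * f u := by
  simp only [Finset.sum_mul]
  rw [Finset.sum_comm]
  simp only [mul_assoc, ← Finset.mul_sum, Lk_sum]
  rw [Fintype.sum_prod_type, Finset.sum_eq_single p.1.1]
  · have := expand_g0 (f := fun v => f (emb p.1.1 v)) (h p.1.1) (p.1.2.1, p.1.2.2, p.2)
    simp only [emb_surj] at this
    rw [this, Fintype.sum_prod_type]
    refine Finset.sum_congr rfl fun z _ => Finset.sum_congr rfl fun a _ => ?_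
    simp only [psiQ, if_true, one_mul]
    ring
  · intro q _ hq
    refine Finset.sum_eq_zero fun c _ => ?_
    simp [psiQ, Ne.symm hq]
  · simp

lemma shared_zero {R N : ℕ} (Γ : (Fin N → GGV R) → ℂ) (hΓ : Γ ∈ BH.symmStates (GGV R) N)
    (hg : ∀ w x q, Good (fun a t j => slice Γ w x ((q, a, t), j)))
    (hc : ∀ x w w', w ≠ w' → x w = x w' → Γ x = 0)
    (y : Fin N → GGV R) (w w' : Fin N) (hne : w ≠ w') (hq : (y w).1.1 = (y w').1.1) : Γ y = 0 := by
  set q := (y w).1.1 with hqd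
  have key := two_particle (fun u v => Γ (Function.update (Function.update y w (emb q u)) w' (emb q v)))
    ?_ ?_ ?_ ((y w).1.2.1, (y w).1.2.2, (y w).2) ((y w').1.2.1, (y w').1.2.2, (y w').2)
  · have e1 : emb q ((y w).1.2.1, (y w).1.2.2, (y w).2) = y w := rfl
    have e2 : emb q ((y w').1.2.1, (y w').1.2.2, (y w').2) = y w' := by rw [hq]; rfl
    simp only [e1, e2, Function.update_eq_self] at key
    exact key
  · intro u v
    have := hΓ (Equiv.swap w w') (Function.update (Function.update y w (emb q v)) w' (emb q u))
    rw [← this]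
    congr 1
    funext i
    by_cases h1 : i = w
    · subst h1; simp [hne]
    · by_cases h2 : i = w'
      · subst h2; simp [hne]
      · simp [h1, h2, Equiv.swap_apply_of_ne_of_ne]
  · intro u
    refine hc _ w w' hne ?_
    simp [hne]
  · intro v
    have := hg w (Function.update y w' (emb q v)) q
    simpa only [slice, emb, Function.update_comm hne] using this

lemma coef_exists {R N : ℕ} (Γ : (Fin N → GGV R) → ℂ) (hΓ : Γ ∈ BH.symmStates (GGV R) N)
    (hg : ∀ w x q, Good (fun a t j => slice Γ w x ((q, a, t), j)))
    (hc : ∀ x w w', w ≠ w' → x w = x w' → Γ x = 0) :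
    ∃ coef : (Fin N → Fin R × Fin 2 × Fin 2) → ℂ,
      (∀ x, Γ x = ∑ c : Fin N → Fin R × Fin 2 × Fin 2,
        coef c * ∏ w, psiQ (c w).1 (c w).2.1 (c w).2.2 (x w)) ∧
      ∀ c, ¬ Function.Injective (fun w => (c w).1) → coef c = 0 := by
  refine ⟨fun c => ∑ y : Fin N → GGV R, (∏ w, Lk (c w) (y w)) * Γ y, ?_, ?_⟩
  · refine kernel_expand (C := Fin R × Fin 2 × Fin 2) (fun c => psiQ c.1 c.2.1 c.2.2) Lk Γ ?_
    intro w x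
    have := slice_expand (slice Γ w x) (hg w x) (x w)
    simp only [slice, Function.update_eq_self] at this
    exact this
  · intro c hinj
    refine Finset.sum_eq_zero fun y _ => ?_
    by_cases hy : ∀ w, (y w).1.1 = (c w).1
    · simp only [Function.Injective, not_forall] at hinj
      obtain ⟨w, w', hw, hne⟩ := hinj
      rw [shared_zero Γ hΓ hg hc y w w' hne (by rw [hy, hy]; exact hw), mul_zero]
    · push Not at hy
      obtain ⟨w, hw⟩ := hy
      rw [Finset.prod_eq_zero (Finset.mem_univ w) (Lk_supp _ _ hw), zero_mul]

lemma forward_I {R N : ℕ} (Γ : (Fin N → GGV R) → ℂ) (hΓ : Γ ∈ BH.symmStates (GGV R) N)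
    (hg : ∀ w x q, Good (fun a t j => slice Γ w x ((q, a, t), j)))
    (hc : ∀ x w w', w ≠ w' → x w = x w' → Γ x = 0) : Γ ∈ Ispace R N := by
  obtain ⟨coef, h1, hz⟩ := coef_exists Γ hΓ hg hc
  rw [symm_expand (C := Fin R × Fin 2 × Fin 2) (fun c => psiQ c.1 c.2.1 c.2.2) Γ hΓ coef h1]
  refine Submodule.sum_mem _ fun c _ => ?_
  by_cases hinj : Function.Injective (fun w => (c w).1)
  · refine Submodule.smul_mem _ _ (Submodule.subset_span ?_)
    exact ⟨fun w => (c w).2.1, fun w => (c w).2.2, fun w => (c w).1, hinj, rfl⟩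
  · rw [hz c hinj, zero_mul, zero_div, zero_smul]
    exact Submodule.zero_mem _

lemma I_zero {R N : ℕ} (Γ : (Fin N → GGV R) → ℂ) (h : Γ ∈ Ispace R N) (x : Fin N → GGV R)
    (w w' : Fin N) (hne : w ≠ w') (hx : x w = x w') : Γ x = 0 := by
  induction h using Submodule.span_induction with
  | mem v hv =>
    obtain ⟨z, a, q, hq, rfl⟩ := hv
    simp only [symSt]
    rw [Finset.sum_eq_zero, mul_zero]
    intro σ _
    by_cases h1 : (x w).1.1 = q (σ w)
    · refine Finset.prod_eq_zero (Finset.mem_univ w') ?_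
      have : (x w').1.1 ≠ q (σ w') := by
        rw [← hx, h1]
        intro h
        exact hne (σ.injective (hq h))
      simp [psiQ, this]
    · refine Finset.prod_eq_zero (Finset.mem_univ w) ?_
      simp [psiQ, h1]
  | zero => rfl
  | add u v _ _ hu hv => simp [hu, hv]
  | smul c v _ hv => simp [hv]

theorem final {R : ℕ} (hR : 1 ≤ R)
    (S : Finset (GNode R)) (E : Finset (Sym2 (GNode R))) (N : ℕ)
    (Γ : (Fin N → GGV R) → ℂ)
    (hΓ : Γ ∈ BH.symmStates (GGV R) N) :
    (BH.bhHam (AG S E) N).mulVec Γ = ((N : ℂ) * (e1 : ℂ)) • Γ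
      ↔ ((∀ w : Fin N,
            (BH.onFactor N (AG S E - (e1 : ℂ) • 1) w).mulVec Γ = 0)
          ∧ Γ ∈ Ispace R N) := by
  constructor
  · intro h
    haveI : Nonempty (GGV R) := ⟨((⟨0, hR⟩, 0, 0), 0)⟩
    obtain ⟨h1, h2⟩ := ground (AG S E) e1 Γ (fun f => (AG_form S E f).1) h
    refine ⟨fun w => ?_, forward_I Γ hΓ (fun w x q => (AG_form S E _).2 (h1 w x) q) h2⟩
    funext x
    rw [onFactor_mulVec, AG_zero S E _ (h1 w x)]
    rfl
  · rintro ⟨h1, h2⟩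
    exact backward _ _ Γ h1 fun x w w' hne hx => I_zero Γ h2 x w w' hne hx

end FF

/-- Let `G` be an `e₁`-gate graph with `R` diagram elements and let
`N ≥ 1`.  A state `Γ ∈ Z_N(G)` satisfies `H(G,N)Γ = 0` (i.e., `Γ` is an `N`-particle
frustration-free state for `G`) if and only if both of the following hold:
(i) `(A(G) − e₁·1)^{(w)} Γ = 0` for every `w ∈ {1,…,N}`, and (ii) `Γ ∈ I(G,N)`.
Here `H(G,N)` is the restriction of `H_G^N − N e₁ · 1` to `Z_N(G)`, so for `Γ ∈ Z_N(G)`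
the condition `H(G,N)Γ = 0` reads `H_G^N Γ = N e₁ Γ`. -/
theorem frustration_free_characterization
    (R : ℕ) (hR : 1 ≤ R)
    (S : Finset (GNode R)) (E : Finset (Sym2 (GNode R)))
    (hvalid : ValidDiagram S E)
    (he1 : BH.mu (AG S E) = e1)
    (N : ℕ) (hN : 1 ≤ N)
    (Γ : (Fin N → GGV R) → ℂ)
    (hΓ : Γ ∈ BH.symmStates (GGV R) N) :
    (BH.bhHam (AG S E) N).mulVec Γ = ((N : ℂ) * (e1 : ℂ)) • Γ
      ↔ ((∀ w : Fin N,
            (BH.onFactor N (AG S E - (e1 : ℂ) • 1) w).mulVec Γ = 0)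
          ∧ Γ ∈ Ispace R N) := by
  exact FF.final hR S E N Γ hΓ
end

section
/- For every unit vector ψ_in ∈ (ℂ²)^{⊗n_in}, the smallest eigenvalue of A_x is at most e₁ + (1 − AP(ψ_in))/(2M), where e₁ = −1 − 3√2 and AP(ψ_in) = ‖ (|1⟩⟨1|)_out · U_C (ψ_in ⊗ |0⟩^{⊗(n−n_in)}) ‖² is the acceptance probability of the circuit on input ψ_in. -/
open scoped Matrix

namespace QC

/-- `ω = e^{iπ/4}`. -/
noncomputable def omega : ℂ := Complex.exp (Real.pi * Complex.I / 4)

/-- The cyclic shift on `ℂ⁸`: `S|j⟩ = |j+1 mod 8⟩`. -/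
noncomputable def S8 : Matrix (Fin 8) (Fin 8) ℂ :=
  Matrix.of fun i j => if i = j + 1 then 1 else 0

/-- `|ω⟩ = (1/√8) Σ_{j=0}^{7} ω^{−j} |j⟩`. -/
noncomputable def omegaVec : Fin 8 → ℂ :=
  fun j => ((1 : ℝ) / Real.sqrt 8 : ℝ) * omega ^ (-(j : ℤ))

/-- `|ω*⟩ = (1/√8) Σ_{j=0}^{7} ω^{j} |j⟩`. -/
noncomputable def omegaStarVec : Fin 8 → ℂ :=
  fun j => ((1 : ℝ) / Real.sqrt 8 : ℝ) * omega ^ (j : ℕ)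

/-- The Hadamard gate `H = (1/√2)[[1,1],[1,−1]]`. -/
noncomputable def Hmat : Matrix (Fin 2) (Fin 2) ℂ :=
  ((1 : ℝ) / Real.sqrt 2 : ℝ) • (!![1, 1; 1, -1] : Matrix (Fin 2) (Fin 2) ℂ)

/-- The gate `T = diag(1, ω)`. -/
noncomputable def Tmat : Matrix (Fin 2) (Fin 2) ℂ := !![1, 0; 0, omega]

/-- For a matrix `W` all of whose entries are `0` or integer powers of `ω`, the operator
`B(W)` obtained by replacing each entry `ω^k` by `S^k` (and each zero entry by the zero
block): since `(S^k)_{ij} = [i−j ≡ k (mod 8)]` and the powers `ω^0,…,ω^7` are distinct,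
this is implemented by `B(W)_{(a,i),(b,j)} = [W a b = ω^{(i−j) mod 8}]`. -/
noncomputable def Bmat {κ : Type*} (W : Matrix κ κ ℂ) :
    Matrix (κ × Fin 8) (κ × Fin 8) ℂ :=
  Matrix.of fun p q => if W p.1 q.1 = omega ^ ((p.2 - q.2 : Fin 8) : ℕ) then 1 else 0

/-- Computational basis configurations of `n` qubits. -/
abbrev QState (n : ℕ) := Fin n → Fin 2

/-- A single-qubit gate `g` applied to qubit `q` of `n` qubits (tensored with the
identity on the remaining qubits). -/
noncomputable def applySingle (n : ℕ) (g : Matrix (Fin 2) (Fin 2) ℂ) (q : Fin n) :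
    Matrix (QState n) (QState n) ℂ :=
  Matrix.of fun x y =>
    (if ∀ u, u ≠ q → x u = y u then (1 : ℂ) else 0) * g (x q) (y q)

/-- A two-qubit gate `g` applied to the ordered pair of qubits `(q, r)` of `n` qubits. -/
noncomputable def applyTwo (n : ℕ) (g : Matrix (Fin 2 × Fin 2) (Fin 2 × Fin 2) ℂ)
    (q r : Fin n) : Matrix (QState n) (QState n) ℂ :=
  Matrix.of fun x y =>
    (if ∀ u, u ≠ q → u ≠ r → x u = y u then (1 : ℂ) else 0) * g (x q, x r) (y q, y r)

/-- The controlled-NOT gate (first qubit control): `|a,b⟩ ↦ |a, b⊕a⟩`. -/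
noncomputable def CNOTmat : Matrix (Fin 2 × Fin 2) (Fin 2 × Fin 2) ℂ :=
  Matrix.of fun p q => if p.1 = q.1 ∧ p.2 = q.2 + q.1 then 1 else 0

/-- The two-qubit gate `(H⊗1)·CNOT`. -/
noncomputable def HCNOT : Matrix (Fin 2 × Fin 2) (Fin 2 × Fin 2) ℂ :=
  (Matrix.of fun p q : Fin 2 × Fin 2 =>
    Hmat p.1 q.1 * (if p.2 = q.2 then (1 : ℂ) else 0)) * CNOTmat

/-- A gate of the circuit: one of `H`, `HT`, `(HT)†` applied to a single qubit, or
`(H⊗1)·CNOT` applied to an ordered pair of distinct qubits. -/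
def AllowedGate (n : ℕ) (Ug : Matrix (QState n) (QState n) ℂ) : Prop :=
  (∃ q : Fin n, Ug = applySingle n Hmat q ∨ Ug = applySingle n (Hmat * Tmat) q
      ∨ Ug = applySingle n ((Hmat * Tmat)ᴴ) q)
  ∨ (∃ q r : Fin n, q ≠ r ∧ Ug = applyTwo n HCNOT q r)

/-- `W_t = U_t` for `1 ≤ t ≤ M` and `W_t = U_{2M+1−t}†` for `M+1 ≤ t ≤ 2M`
(0-indexed: `W_s = U_s` for `s < M` and `W_s = (U_{2M−1−s})†` otherwise). -/
noncomputable def Wseq (n M : ℕ) (U : ℕ → Matrix (QState n) (QState n) ℂ) (t : ℕ) :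
    Matrix (QState n) (QState n) ℂ :=
  if t < M then U t else (U (2 * M - 1 - t))ᴴ

/-- The cyclic successor on `Fin m` (realizing the periodic clock convention
`|2M+1⟩ = |1⟩`). -/
def cycSucc {m : ℕ} (s : Fin m) : Fin m :=
  ⟨((s : ℕ) + 1) % m, Nat.mod_lt _ s.pos⟩

/-- The vertex set used in the circuit-to-graph construction:
`(ℂ²)^{⊗n} ⊗ ℂ^{2M} ⊗ ℂ⁸` (clock labels `1,…,2M` represented by `Fin (2M)` with label
`t ↔ index t−1`). -/
abbrev CVertex (n M : ℕ) := QState n × Fin (2 * M) × Fin 8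

/-- `H_prop = Σ_{t=1}^{2M}( (B(W_t)†)_{13}⊗(|t⟩⟨t+1|)_2 + (B(W_t))_{13}⊗(|t+1⟩⟨t|)_2 )`,
where `B(W_t)` is obtained from `−√2·W_t` by the substitution `ω^k ↦ S^k`. -/
noncomputable def HpropC (n M : ℕ) (U : ℕ → Matrix (QState n) (QState n) ℂ) :
    Matrix (CVertex n M) (CVertex n M) ℂ :=
  Matrix.of fun p q => ∑ s : Fin (2 * M),
    ((if p.2.1 = s ∧ q.2.1 = cycSucc s then
        (Bmat ((-(Real.sqrt 2) : ℂ) • Wseq n M U (s : ℕ)))ᴴ (p.1, p.2.2) (q.1, q.2.2)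
      else 0)
      + (if p.2.1 = cycSucc s ∧ q.2.1 = s then
        Bmat ((-(Real.sqrt 2) : ℂ) • Wseq n M U (s : ℕ)) (p.1, p.2.2) (q.1, q.2.2)
      else 0))

/-- `H_penalty = 1 ⊗ 1 ⊗ (S³ + S⁴ + S⁵)`. -/
noncomputable def HpenC (n M : ℕ) : Matrix (CVertex n M) (CVertex n M) ℂ :=
  Matrix.of fun p q =>
    if p.1 = q.1 ∧ p.2.1 = q.2.1 then (S8 ^ 3 + S8 ^ 4 + S8 ^ 5) p.2.2 q.2.2 else 0

/-- `H_input = Σ_{j=n_in+1}^{n} (|1⟩⟨1|)_j ⊗ |1⟩⟨1| ⊗ 1` (the middle projector onto the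
clock state `|1⟩`, which is the clock index `0`). -/
noncomputable def HinC (n M nin : ℕ) : Matrix (CVertex n M) (CVertex n M) ℂ :=
  Matrix.of fun p q =>
    if p = q ∧ (p.2.1 : ℕ) = 0 then
      ((Finset.univ.filter fun j : Fin n => nin ≤ (j : ℕ) ∧ p.1 j = 1).card : ℂ)
    else 0

/-- `H_output = (|0⟩⟨0|)_out ⊗ |M+1⟩⟨M+1| ⊗ 1` (clock label `M+1` is clock index `M`). -/
noncomputable def HoutC (n M : ℕ) (out : Fin n) :
    Matrix (CVertex n M) (CVertex n M) ℂ :=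
  Matrix.of fun p q =>
    if p = q ∧ p.1 out = 0 ∧ (p.2.1 : ℕ) = M then 1 else 0

/-- The symmetric 0-1 matrix `A_x = H_prop + H_penalty + H_input + H_output`. -/
noncomputable def Ax (n M nin : ℕ) (out : Fin n)
    (U : ℕ → Matrix (QState n) (QState n) ℂ) :
    Matrix (CVertex n M) (CVertex n M) ℂ :=
  HpropC n M U + HpenC n M + HinC n M nin + HoutC n M out

/-- `e₁ = −1 − 3√2`. -/
noncomputable def e1 : ℝ := -1 - 3 * Real.sqrt 2

/-- `U_C = U_M ⋯ U_1` (0-indexed: `U_{M−1} ⋯ U_0`). -/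
noncomputable def circuitU (n M : ℕ) (U : ℕ → Matrix (QState n) (QState n) ℂ) :
    Matrix (QState n) (QState n) ℂ :=
  ((List.range M).reverse.map U).prod

/-- The input state `ψ ⊗ |0⟩^{⊗(n−n_in)}` for `ψ ∈ (ℂ²)^{⊗n_in}`. -/
noncomputable def embedInput (n nin : ℕ) (h : nin ≤ n) (ψ : QState nin → ℂ) :
    QState n → ℂ :=
  fun x => (if ∀ j : Fin n, nin ≤ (j : ℕ) → x j = 0 then (1 : ℂ) else 0)
    * ψ (fun i : Fin nin => x (Fin.castLE h i))

/-- The acceptance probability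
`AP(ψ) = ‖ (|1⟩⟨1|)_out · U_C (ψ ⊗ |0⟩^{⊗(n−n_in)}) ‖²`. -/
noncomputable def acceptProb (n M nin : ℕ) (h : nin ≤ n) (out : Fin n)
    (U : ℕ → Matrix (QState n) (QState n) ℂ) (ψ : QState nin → ℂ) : ℝ :=
  ∑ x : QState n,
    if x out = 1 then
      Complex.normSq ((circuitU n M U).mulVec (embedInput n nin h ψ) x)
    else 0

end QC

namespace QC

/-- The smallest eigenvalue of a Hermitian matrix `H`, characterized as the infimum of
the Rayleigh quotients `⟨ψ, H ψ⟩` over unit vectors `ψ`. -/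
noncomputable def smallestEigenvalue {ι : Type*} [Fintype ι] (H : Matrix ι ι ℂ) : ℝ :=
  sInf { r : ℝ | ∃ ψ : ι → ℂ, dotProduct (star ψ) ψ = 1 ∧
    r = (dotProduct (star ψ) (H.mulVec ψ)).re }

end QC

namespace QC

lemma omega_prim : IsPrimitiveRoot omega 8 := by
  have h := Complex.isPrimitiveRoot_exp 8 (by norm_num)
  have e : omega = Complex.exp (2 * Real.pi * Complex.I / (8 : ℕ)) := by
    unfold omega; congr 1; push_cast; ring
  rw [e]; exact h

lemma omega_ne : omega ≠ 0 := Complex.exp_ne_zero _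

lemma omega8 : omega ^ 8 = 1 := omega_prim.pow_eq_one

lemma omega4 : omega ^ 4 = -1 := by
  have h : (omega ^ 4) ^ 2 = 1 := by rw [← pow_mul]; exact omega8
  rcases mul_self_eq_one_iff.mp ((sq (omega ^ 4)).symm.trans h) with h | h
  · exact absurd h (omega_prim.pow_ne_one_of_pos_of_lt (by norm_num) (by norm_num))
  · exact h

lemma conj_omega : star omega = omega⁻¹ := by
  have h : star omega * omega = 1 := by
    unfold omega
    rw [Complex.star_def, ← Complex.exp_conj, ← Complex.exp_add]
    simp [Complex.exp_eq_one_iff]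
    use 0
    rw [show (starRingEnd ℂ) 4 = 4 from Complex.conj_ofReal 4 ▸ by norm_num]
    push_cast
    ring
  exact eq_inv_of_mul_eq_one_left h

lemma omega_mod (k : ℕ) : omega ^ (k % 8) = omega ^ k := by
  conv_rhs => rw [← Nat.mod_add_div k 8, pow_add, pow_mul, omega8, one_pow, mul_one]

lemma omega_add (i j : Fin 8) : omega ^ ((i + j : Fin 8) : ℕ) = omega ^ (i : ℕ) * omega ^ (j : ℕ) := by
  rw [Fin.val_add, omega_mod, pow_add]

lemma omega_fin_inj {i j : Fin 8} : omega ^ (i : ℕ) = omega ^ (j : ℕ) ↔ i = j :=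
  ⟨fun h => Fin.ext (omega_prim.pow_inj i.2 j.2 h), fun h => by rw [h]⟩

lemma omegaVec_eq (j : Fin 8) :
    omegaVec j = ((1 : ℝ) / Real.sqrt 8 : ℝ) * (omega ^ (j : ℕ))⁻¹ := by
  simp [omegaVec]

lemma omegaVec_add (i k : Fin 8) : omegaVec i = omega ^ (k : ℕ) * omegaVec (i + k) := by
  rw [omegaVec_eq, omegaVec_eq, omega_add]
  have := pow_ne_zero (k : ℕ) omega_ne
  field_simp

lemma omegaVec_norm : ∑ j, star (omegaVec j) * omegaVec j = 1 := by
  have : ∀ j, star (omegaVec j) * omegaVec j = 1 / 8 := by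
    intro j
    rw [omegaVec_eq, star_mul', star_inv₀, star_pow, conj_omega, inv_pow, inv_inv]
    have h8 : ((Real.sqrt 8 : ℝ) : ℂ) * (Real.sqrt 8 : ℝ) = 8 := by
      rw [← Complex.ofReal_mul, Real.mul_self_sqrt (by norm_num)]; norm_num
    have h0 : ((Real.sqrt 8 : ℝ) : ℂ) ≠ 0 := by
      intro h; rw [h] at h8; norm_num at h8
    have := pow_ne_zero (j : ℕ) omega_ne
    rw [Complex.star_def, Complex.conj_ofReal]
    push_cast
    field_simp
    rw [sq, h8]
  simp only [this]
  simp

lemma S8_omega : S8 *ᵥ omegaVec = omega • omegaVec := by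
  ext i
  simp only [Matrix.mulVec, dotProduct, S8, Matrix.of_apply, Pi.smul_apply, smul_eq_mul]
  rw [Finset.sum_eq_single (i - 1)]
  · simp only [sub_add_cancel, if_true, one_mul]
    rw [omegaVec_add (i - 1) 1]; simp
  · intro b _ hb
    rw [if_neg, zero_mul]
    intro h; exact hb (by rw [h]; simp)
  · simp

lemma omega_re : omega ^ 3 + omega ^ 4 + omega ^ 5 = -1 - (Real.sqrt 2 : ℂ) := by
  have h5 : omega ^ 5 = - omega := by rw [pow_succ, omega4]; ring
  have h3 : omega ^ 3 = - omega⁻¹ := by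
    have := omega_ne
    field_simp
    exact omega4
  rw [h5, h3, omega4, ← conj_omega]
  have : omega + star omega = (Real.sqrt 2 : ℂ) := by
    rw [Complex.star_def, Complex.add_conj]
    have : omega.re = Real.sqrt 2 / 2 := by
      unfold omega
      rw [show ((Real.pi : ℂ) * Complex.I / 4) = ((Real.pi / 4 : ℝ) : ℂ) * Complex.I by push_cast; ring]
      rw [Complex.exp_ofReal_mul_I_re, Real.cos_pi_div_four]
    rw [this]; push_cast; ring
  linear_combination -this

lemma pen_omega : (S8 ^ 3 + S8 ^ 4 + S8 ^ 5) *ᵥ omegaVec = (-1 - (Real.sqrt 2 : ℂ)) • omegaVec := by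
  have h : ∀ k : ℕ, (S8 ^ k) *ᵥ omegaVec = omega ^ k • omegaVec := by
    intro k
    induction k with
    | zero => simp
    | succ k ih =>
      rw [pow_succ, ← Matrix.mulVec_mulVec, S8_omega, Matrix.mulVec_smul, ih, smul_smul, pow_succ,
        mul_comm]
  rw [Matrix.add_mulVec, Matrix.add_mulVec, h, h, h, ← add_smul, ← add_smul, omega_re]

/-- entries which are zero or powers of omega -/
def Pow0 (z : ℂ) : Prop := z = 0 ∨ ∃ k : Fin 8, z = omega ^ (k : ℕ)

lemma Pow0.of_pow (k : ℕ) : Pow0 (omega ^ k) :=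
  Or.inr ⟨⟨k % 8, Nat.mod_lt _ (by norm_num)⟩, (omega_mod k).symm⟩

lemma Pow0.star {z : ℂ} (h : Pow0 z) : Pow0 (star z) := by
  rcases h with rfl | ⟨k, rfl⟩
  · left; simp
  · rw [star_pow, conj_omega]
    have : omega⁻¹ = omega ^ 7 := by
      have := omega_ne
      field_simp
      exact omega8.symm
    rw [this, ← pow_mul]; exact Pow0.of_pow _

lemma B_row {z : ℂ} (h : Pow0 z) (i : Fin 8) :
    ∑ j : Fin 8, (if z = omega ^ ((i - j : Fin 8) : ℕ) then (1 : ℂ) else 0) * omegaVec j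
      = z * omegaVec i := by
  rcases h with rfl | ⟨k, rfl⟩
  · have : ∀ m : ℕ, (0 : ℂ) ≠ omega ^ m := fun m => (pow_ne_zero m omega_ne).symm
    simp [this]
  · rw [Finset.sum_eq_single (i - k)]
    · rw [omegaVec_add (i - k) k]; simp
    · intro b _ hb
      rw [if_neg, zero_mul]
      rw [omega_fin_inj]
      rintro rfl; exact hb (by simp)
    · simp

lemma B_col {z : ℂ} (h : Pow0 z) (i : Fin 8) :
    ∑ j : Fin 8, (if z = omega ^ ((j - i : Fin 8) : ℕ) then (1 : ℂ) else 0) * omegaVec j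
      = star z * omegaVec i := by
  rcases h with rfl | ⟨k, rfl⟩
  · have : ∀ m : ℕ, (0 : ℂ) ≠ omega ^ m := fun m => (pow_ne_zero m omega_ne).symm
    simp [this]
  · rw [Finset.sum_eq_single (i + k)]
    · rw [omegaVec_add i k, star_pow, conj_omega]
      have := pow_ne_zero (k : ℕ) omega_ne
      simp
      field_simp
    · intro b _ hb
      rw [if_neg, zero_mul]
      rw [omega_fin_inj]
      rintro rfl; exact hb (by simp)
    · simp

/-- Every entry of the matrix times minus root two is zero or a power of omega. -/
def GoodM {κ : Type*} (W : Matrix κ κ ℂ) : Prop := ∀ a b, Pow0 ((-(Real.sqrt 2) : ℂ) * W a b)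

lemma GoodM.conjT {κ : Type*} {W : Matrix κ κ ℂ} (h : GoodM W) : GoodM Wᴴ := by
  intro a b
  have := (h b a).star
  rw [star_mul'] at this
  simpa using this

lemma Bmat_mul {κ : Type*} [Fintype κ] {W : Matrix κ κ ℂ} (h : GoodM W) (v : κ → ℂ)
    (x : κ) (i : Fin 8) :
    ∑ y : κ, ∑ j : Fin 8, Bmat ((-(Real.sqrt 2) : ℂ) • W) (x, i) (y, j) * (v y * omegaVec j)
      = -(Real.sqrt 2) * (W *ᵥ v) x * omegaVec i := by
  simp only [Matrix.mulVec, dotProduct, Finset.mul_sum, Finset.sum_mul]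
  refine Finset.sum_congr rfl fun y _ => ?_
  have := B_row (h x y) i
  simp only [Bmat, Matrix.of_apply, Matrix.smul_apply, smul_eq_mul]
  rw [← mul_assoc, mul_right_comm, ← this, Finset.sum_mul]
  refine Finset.sum_congr rfl fun j _ => ?_
  ring

lemma Bmat_mulT {κ : Type*} [Fintype κ] {W : Matrix κ κ ℂ} (h : GoodM W) (v : κ → ℂ)
    (x : κ) (i : Fin 8) :
    ∑ y : κ, ∑ j : Fin 8, (Bmat ((-(Real.sqrt 2) : ℂ) • W))ᴴ (x, i) (y, j) * (v y * omegaVec j)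
      = -(Real.sqrt 2) * (Wᴴ *ᵥ v) x * omegaVec i := by
  simp only [Matrix.mulVec, dotProduct, Finset.mul_sum, Finset.sum_mul]
  refine Finset.sum_congr rfl fun y _ => ?_
  have := B_col (h y x) i
  rw [star_mul'] at this
  simp only [star_neg, Complex.star_def, Complex.conj_ofReal] at this
  simp only [Bmat, Matrix.of_apply, Matrix.smul_apply, smul_eq_mul, Matrix.conjTranspose_apply,
    Complex.star_def, apply_ite (starRingEnd ℂ), map_one, map_zero]
  rw [← mul_assoc, mul_right_comm, ← this, Finset.sum_mul]
  refine Finset.sum_congr rfl fun j _ => ?_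
  ring

lemma sum_single {n : ℕ} (q : Fin n) (x : QState n) (F : QState n → ℂ) :
    (∑ z : QState n, if ∀ u, u ≠ q → z u = x u then F z else 0)
      = ∑ a : Fin 2, F (Function.update x q a) := by
  rw [← Finset.sum_filter]
  refine Finset.sum_nbij' (fun z => z q) (fun a => Function.update x q a) ?_ ?_ ?_ ?_ ?_
  · simp
  · intro a _
    simp only [Finset.mem_filter, Finset.mem_univ, true_and]
    intro u hu; simp [hu]
  · intro z hz
    simp only [Finset.mem_filter, Finset.mem_univ, true_and] at hz
    ext u
    by_cases hu : u = q
    · subst hu; simp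
    · simp [hu, hz u hu]
  · simp
  · intro z hz
    simp only [Finset.mem_filter, Finset.mem_univ, true_and] at hz
    congr 1
    ext u
    by_cases hu : u = q
    · subst hu; simp
    · simp [hu, hz u hu]

lemma sum_two {n : ℕ} (q r : Fin n) (hqr : q ≠ r) (x : QState n) (F : QState n → ℂ) :
    (∑ z : QState n, if ∀ u, u ≠ q → u ≠ r → z u = x u then F z else 0)
      = ∑ a : Fin 2 × Fin 2, F (Function.update (Function.update x q a.1) r a.2) := by
  have key : ∀ z : QState n, (∀ u, u ≠ q → u ≠ r → z u = x u) →
      Function.update (Function.update x q (z q)) r (z r) = z := by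
    intro z hz
    ext u
    by_cases hu : u = r
    · subst hu; simp
    · by_cases hu' : u = q
      · subst hu'; simp [hu]
      · simp [hu, hu', hz u hu' hu]
  rw [← Finset.sum_filter]
  refine Finset.sum_nbij' (fun z => (z q, z r))
    (fun a => Function.update (Function.update x q a.1) r a.2) ?_ ?_ ?_ ?_ ?_
  · simp
  · intro a _
    simp only [Finset.mem_filter, Finset.mem_univ, true_and]
    intro u hu hu'; simp [hu, hu']
  · intro z hz
    simp only [Finset.mem_filter, Finset.mem_univ, true_and] at hz
    exact key z hz
  · intro a _
    simp [hqr]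
  · intro z hz
    simp only [Finset.mem_filter, Finset.mem_univ, true_and] at hz
    rw [key z hz]

lemma applySingle_iso {n : ℕ} {g : Matrix (Fin 2) (Fin 2) ℂ} (hg : gᴴ * g = 1) (q : Fin n) :
    (applySingle n g q)ᴴ * applySingle n g q = 1 := by
  ext x y
  rw [Matrix.mul_apply]
  have h1 : ∀ z, (applySingle n g q)ᴴ x z * applySingle n g q z y =
      if ∀ u, u ≠ q → z u = x u then
        star (g (z q) (x q)) * ((if ∀ u, u ≠ q → z u = y u then (1 : ℂ) else 0) * g (z q) (y q))
      else 0 := by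
    intro z
    simp only [applySingle, Matrix.conjTranspose_apply, Matrix.of_apply]
    split_ifs <;> simp
  simp only [h1]
  rw [sum_single]
  have h2 : ∀ a : Fin 2, (∀ u, u ≠ q → Function.update x q a u = y u) ↔ (∀ u, u ≠ q → x u = y u) := by
    intro a
    refine forall_congr' fun u => ?_
    by_cases hu : u = q
    · simp [hu]
    · simp [hu]
  simp only [h2, Function.update_self]
  have h3 : ∑ a, star (g a (x q)) * g a (y q) = (1 : Matrix (Fin 2) (Fin 2) ℂ) (x q) (y q) := by
    rw [← hg, Matrix.mul_apply]; rfl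
  by_cases h : ∀ u, u ≠ q → x u = y u
  · simp only [if_pos h, one_mul]
    rw [h3, Matrix.one_apply, Matrix.one_apply]
    congr 1
    refine propext ⟨fun h' => funext fun u => ?_, fun h' => by rw [h']⟩
    by_cases hu : u = q
    · rw [hu, h']
    · exact h u hu
  · simp only [if_neg h, zero_mul, mul_zero, Finset.sum_const_zero]
    rw [Matrix.one_apply_ne]
    rintro rfl; exact h fun _ _ => rfl

lemma applyTwo_iso {n : ℕ} {g : Matrix (Fin 2 × Fin 2) (Fin 2 × Fin 2) ℂ} (hg : gᴴ * g = 1)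
    (q r : Fin n) (hqr : q ≠ r) :
    (applyTwo n g q r)ᴴ * applyTwo n g q r = 1 := by
  ext x y
  rw [Matrix.mul_apply]
  have h1 : ∀ z, (applyTwo n g q r)ᴴ x z * applyTwo n g q r z y =
      if ∀ u, u ≠ q → u ≠ r → z u = x u then
        star (g (z q, z r) (x q, x r)) *
          ((if ∀ u, u ≠ q → u ≠ r → z u = y u then (1 : ℂ) else 0) * g (z q, z r) (y q, y r))
      else 0 := by
    intro z
    simp only [applyTwo, Matrix.conjTranspose_apply, Matrix.of_apply]
    split_ifs <;> simp
  simp only [h1]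
  rw [sum_two q r hqr]
  have h2 : ∀ a : Fin 2 × Fin 2,
      (∀ u, u ≠ q → u ≠ r → Function.update (Function.update x q a.1) r a.2 u = y u) ↔
        (∀ u, u ≠ q → u ≠ r → x u = y u) := by
    intro a
    refine forall_congr' fun u => ?_
    by_cases hu : u = q
    · simp [hu]
    · by_cases hu' : u = r
      · simp [hu']
      · simp [hu, hu']
  simp only [h2, Function.update_self, Function.update_of_ne hqr, Prod.mk.eta]
  have h3 : ∑ a, star (g a (x q, x r)) * g a (y q, y r)
      = (1 : Matrix (Fin 2 × Fin 2) (Fin 2 × Fin 2) ℂ) (x q, x r) (y q, y r) := by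
    rw [← hg, Matrix.mul_apply]; rfl
  by_cases h : ∀ u, u ≠ q → u ≠ r → x u = y u
  · simp only [if_pos h, one_mul]
    rw [h3, Matrix.one_apply, Matrix.one_apply]
    congr 1
    refine propext ⟨fun h' => funext fun u => ?_, fun h' => by rw [h']⟩
    rw [Prod.mk.injEq] at h'
    by_cases hu : u = q
    · rw [hu, h'.1]
    · by_cases hu' : u = r
      · rw [hu', h'.2]
      · exact h u hu hu'
  · simp only [if_neg h, zero_mul, mul_zero, Finset.sum_const_zero]
    rw [Matrix.one_apply_ne]
    rintro rfl; exact h fun _ _ _ => rfl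

lemma applySingle_good {n : ℕ} {g : Matrix (Fin 2) (Fin 2) ℂ} (hg : GoodM g) (q : Fin n) :
    GoodM (applySingle n g q) := by
  intro x y
  simp only [applySingle, Matrix.of_apply]
  split_ifs
  · simpa using hg _ _
  · left; simp

lemma applyTwo_good {n : ℕ} {g : Matrix (Fin 2 × Fin 2) (Fin 2 × Fin 2) ℂ} (hg : GoodM g)
    (q r : Fin n) : GoodM (applyTwo n g q r) := by
  intro x y
  simp only [applyTwo, Matrix.of_apply]
  split_ifs
  · simpa using hg _ _
  · left; simp

lemma sqrt2_sq : ((Real.sqrt 2 : ℝ) : ℂ) * (Real.sqrt 2 : ℝ) = 2 := by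
  rw [← Complex.ofReal_mul, Real.mul_self_sqrt (by norm_num)]; norm_num

lemma sqrt2_ne : ((Real.sqrt 2 : ℝ) : ℂ) ≠ 0 := by
  intro h; have := sqrt2_sq; rw [h] at this; norm_num at this

lemma H_good : GoodM Hmat := by
  have h0 : Pow0 1 := by simpa using Pow0.of_pow 0
  have h4 : Pow0 (-1) := by simpa [omega4] using Pow0.of_pow 4
  have := sqrt2_ne
  intro a b
  fin_cases a <;> fin_cases b <;> simp [Hmat, this, h0, h4]

lemma H_herm : Hmatᴴ = Hmat := by
  ext a b
  fin_cases a <;> fin_cases b <;> simp [Hmat]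

lemma H_iso : Hmatᴴ * Hmat = 1 := by
  rw [H_herm]
  have h := sqrt2_ne
  have h2 : (((Real.sqrt 2 : ℝ) : ℂ))⁻¹ * ((Real.sqrt 2 : ℝ) : ℂ)⁻¹ = 1 / 2 := by
    rw [← mul_inv, sqrt2_sq]; norm_num
  ext a b
  fin_cases a <;> fin_cases b <;> simp [Hmat, Matrix.mul_apply, h2] <;> norm_num

lemma T_iso : Tmatᴴ * Tmat = 1 := by
  have := omega_ne
  have hc := conj_omega
  rw [Complex.star_def] at hc
  ext a b
  fin_cases a <;> fin_cases b <;> simp [Tmat, Matrix.mul_apply, this, hc]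

lemma HT_iso : (Hmat * Tmat)ᴴ * (Hmat * Tmat) = 1 := by
  rw [Matrix.conjTranspose_mul, Matrix.mul_assoc, ← Matrix.mul_assoc Hmatᴴ, H_iso, Matrix.one_mul,
    T_iso]

lemma HT_good : GoodM (Hmat * Tmat) := by
  have h0 : Pow0 1 := by simpa using Pow0.of_pow 0
  have h4 : Pow0 (-1) := by simpa [omega4] using Pow0.of_pow 4
  have h1 : Pow0 omega := by simpa using Pow0.of_pow 1
  have h5 : Pow0 (-omega) := by simpa [pow_succ _ 4, omega4] using Pow0.of_pow 5
  have := sqrt2_ne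
  intro a b
  fin_cases a <;> fin_cases b <;> simp [Hmat, Tmat, Matrix.mul_apply, this, h0, h1, h4, h5]

lemma HC_apply (p q : Fin 2 × Fin 2) :
    HCNOT p q = if p.2 = q.2 + q.1 then Hmat p.1 q.1 else 0 := by
  simp only [HCNOT, CNOTmat, Matrix.mul_apply, Matrix.of_apply]
  rw [Finset.sum_eq_single (q.1, q.2 + q.1)]
  · simp
  · intro b _ hb
    rw [if_neg (c := b.1 = q.1 ∧ b.2 = q.2 + q.1), mul_zero]
    rintro ⟨h1, h2⟩; exact hb (Prod.ext h1 h2)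
  · simp

lemma HC_good : GoodM HCNOT := by
  intro p q
  rw [HC_apply]
  split_ifs
  · exact H_good _ _
  · left; simp

lemma HC_iso : HCNOTᴴ * HCNOT = 1 := by
  ext ⟨a, b⟩ ⟨c, d⟩
  have h := congrFun (congrFun H_iso a) c
  rw [Matrix.mul_apply] at h
  simp only [Matrix.conjTranspose_apply] at h
  rw [Matrix.mul_apply, Fintype.sum_prod_type]
  simp only [Matrix.conjTranspose_apply, HC_apply]
  have : ∀ e : Fin 2, (∑ f : Fin 2, star (if f = b + a then Hmat e a else 0) *
      (if f = d + c then Hmat e c else 0))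
      = if b + a = d + c then star (Hmat e a) * Hmat e c else 0 := by
    intro e
    rw [Finset.sum_eq_single (b + a)]
    · by_cases h : b + a = d + c <;> simp [h]
    · intro f _ hf; simp [hf]
    · simp
  simp only [this]
  split_ifs with hab
  · rw [h, Matrix.one_apply, Matrix.one_apply]
    congr 1
    refine propext ⟨?_, ?_⟩
    · rintro rfl
      rw [add_right_cancel hab]
    · intro h'; exact (Prod.mk.inj h').1
  · rw [Finset.sum_const_zero, Matrix.one_apply_ne]
    intro h'
    obtain ⟨rfl, rfl⟩ := Prod.mk.inj h'
    exact hab rfl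

lemma gate_good {n : ℕ} {V : Matrix (QState n) (QState n) ℂ} (h : AllowedGate n V) : GoodM V := by
  rcases h with ⟨q, rfl | rfl | rfl⟩ | ⟨q, r, _, rfl⟩
  · exact applySingle_good H_good q
  · exact applySingle_good HT_good q
  · exact applySingle_good HT_good.conjT q
  · exact applyTwo_good HC_good q r

lemma gate_iso {n : ℕ} {V : Matrix (QState n) (QState n) ℂ} (h : AllowedGate n V) :
    Vᴴ * V = 1 := by
  rcases h with ⟨q, rfl | rfl | rfl⟩ | ⟨q, r, hqr, rfl⟩
  · exact applySingle_iso H_iso q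
  · exact applySingle_iso HT_iso q
  · refine applySingle_iso ?_ q
    rw [Matrix.conjTranspose_conjTranspose]
    exact mul_eq_one_comm.mp HT_iso
  · exact applyTwo_iso HC_iso q r hqr

end QC
namespace QC

/-- History states. -/
noncomputable def vst {n : ℕ} (M : ℕ) (U : ℕ → Matrix (QState n) (QState n) ℂ)
    (Ψ : QState n → ℂ) : ℕ → QState n → ℂ
  | 0 => Ψ
  | t + 1 => Wseq n M U t *ᵥ vst M U Ψ t

lemma circuitU_succ (n k : ℕ) (U : ℕ → Matrix (QState n) (QState n) ℂ) :
    circuitU n (k + 1) U = U k * circuitU n k U := by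
  simp [circuitU, List.range_succ]

lemma vst_circuit {n M : ℕ} (U : ℕ → Matrix (QState n) (QState n) ℂ) (Ψ : QState n → ℂ)
    (k : ℕ) (hk : k ≤ M) : vst M U Ψ k = circuitU n k U *ᵥ Ψ := by
  induction k with
  | zero => simp [vst, circuitU]
  | succ k ih =>
    rw [vst, ih (by omega), circuitU_succ, Wseq, if_pos (by omega), Matrix.mulVec_mulVec]

lemma Wseq_good {n M : ℕ} {U : ℕ → Matrix (QState n) (QState n) ℂ}
    (hU : ∀ i, i < M → AllowedGate n (U i)) (t : ℕ) (ht : t < 2 * M) : GoodM (Wseq n M U t) := by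
  unfold Wseq
  split_ifs with h
  · exact gate_good (hU t h)
  · exact (gate_good (hU _ (by omega))).conjT

lemma Wseq_iso {n M : ℕ} {U : ℕ → Matrix (QState n) (QState n) ℂ}
    (hU : ∀ i, i < M → AllowedGate n (U i)) (t : ℕ) (ht : t < 2 * M) :
    (Wseq n M U t)ᴴ * Wseq n M U t = 1 := by
  unfold Wseq
  split_ifs with h
  · exact gate_iso (hU t h)
  · rw [Matrix.conjTranspose_conjTranspose]
    exact mul_eq_one_comm.mp (gate_iso (hU _ (by omega)))

lemma vst_norm {n M : ℕ} {U : ℕ → Matrix (QState n) (QState n) ℂ}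
    (hU : ∀ i, i < M → AllowedGate n (U i)) (Ψ : QState n → ℂ) (t : ℕ) (ht : t ≤ 2 * M) :
    star (vst M U Ψ t) ⬝ᵥ vst M U Ψ t = star Ψ ⬝ᵥ Ψ := by
  induction t with
  | zero => rfl
  | succ t ih =>
    rw [vst, Matrix.star_mulVec, ← Matrix.dotProduct_mulVec, Matrix.mulVec_mulVec,
      Wseq_iso hU t (by omega), Matrix.one_mulVec, ih (by omega)]

lemma vst_back {n M : ℕ} {U : ℕ → Matrix (QState n) (QState n) ℂ}
    (hU : ∀ i, i < M → AllowedGate n (U i)) (Ψ : QState n → ℂ) (k : ℕ) (hk : k ≤ M) :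
    vst M U Ψ (M + k) = vst M U Ψ (M - k) := by
  induction k with
  | zero => rfl
  | succ k ih =>
    rw [← add_assoc, vst, ih (by omega)]
    obtain ⟨m, hm⟩ : ∃ m, M - k = m + 1 := ⟨M - k - 1, by omega⟩
    rw [hm, show M - (k + 1) = m by omega, vst, Wseq, Wseq, if_neg (by omega), if_pos (by omega),
      show 2 * M - 1 - (M + k) = m by omega, Matrix.mulVec_mulVec, gate_iso (hU m (by omega)),
      Matrix.one_mulVec]

lemma vst_cyc {n M : ℕ} {U : ℕ → Matrix (QState n) (QState n) ℂ}
    (hU : ∀ i, i < M → AllowedGate n (U i)) (Ψ : QState n → ℂ) (s : Fin (2 * M)) :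
    vst M U Ψ (cycSucc s : Fin (2 * M)) = Wseq n M U s *ᵥ vst M U Ψ s := by
  rw [← vst]
  simp only [cycSucc]
  rcases Nat.lt_or_ge ((s : ℕ) + 1) (2 * M) with h | h
  · rw [Nat.mod_eq_of_lt h]
  · have h' : (s : ℕ) + 1 = 2 * M := by have := s.2; omega
    have hb := vst_back hU Ψ M le_rfl
    rw [Nat.sub_self, ← two_mul] at hb
    change vst M U Ψ (((s : ℕ) + 1) % (2 * M)) = vst M U Ψ ((s : ℕ) + 1)
    simp only [h', Nat.mod_self]
    exact hb.symm

lemma cycSucc_bij {m : ℕ} : Function.Bijective (cycSucc : Fin m → Fin m) := by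
  refine Finite.injective_iff_bijective.mp ?_
  intro a b h
  simp only [cycSucc, Fin.mk.injEq] at h
  have ha := a.2
  have hb := b.2
  apply Fin.ext
  rcases Nat.lt_or_ge ((a : ℕ) + 1) m with h1 | h1 <;>
  rcases Nat.lt_or_ge ((b : ℕ) + 1) m with h2 | h2
  · rw [Nat.mod_eq_of_lt h1, Nat.mod_eq_of_lt h2] at h; omega
  · rw [Nat.mod_eq_of_lt h1, show (b : ℕ) + 1 = m by omega, Nat.mod_self] at h; omega
  · rw [Nat.mod_eq_of_lt h2, show (a : ℕ) + 1 = m by omega, Nat.mod_self] at h; omega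
  · omega

/-- Trial state (unnormalised in the clock). -/
noncomputable def trial {n : ℕ} (M : ℕ) (U : ℕ → Matrix (QState n) (QState n) ℂ)
    (Ψ : QState n → ℂ) : CVertex n M → ℂ :=
  fun p => vst M U Ψ p.2.1 p.1 * omegaVec p.2.2

lemma prop_trial {n M : ℕ} {U : ℕ → Matrix (QState n) (QState n) ℂ}
    (hU : ∀ i, i < M → AllowedGate n (U i)) (Ψ : QState n → ℂ) :
    HpropC n M U *ᵥ trial M U Ψ = (-2 * (Real.sqrt 2 : ℂ)) • trial M U Ψ := by
  ext ⟨x, t, i⟩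
  simp only [Matrix.mulVec, dotProduct, HpropC, Matrix.of_apply, Fintype.sum_prod_type,
    Pi.smul_apply, smul_eq_mul, Finset.sum_mul, add_mul, Finset.sum_add_distrib]
  have key1 : ∀ s : Fin (2 * M),
      (∑ y : QState n, ∑ t' : Fin (2 * M), ∑ j : Fin 8,
        (if t = s ∧ t' = cycSucc s then
          (Bmat ((-(Real.sqrt 2) : ℂ) • Wseq n M U (s : ℕ)))ᴴ (x, i) (y, j) else 0)
          * trial M U Ψ (y, t', j))
      = if t = s then -(Real.sqrt 2) * trial M U Ψ (x, t, i) else 0 := by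
    intro s
    by_cases hts : t = s
    · subst hts
      rw [if_pos rfl]
      have h := Bmat_mulT (Wseq_good hU t t.2) (vst M U Ψ (cycSucc t : Fin (2 * M))) x i
      refine Eq.trans ?_ (h.trans ?_)
      · refine Finset.sum_congr rfl fun y _ => ?_
        rw [Finset.sum_eq_single (cycSucc t)]
        · simp [trial]
        · intro b _ hb
          simp [hb]
        · simp
      · rw [vst_cyc hU, Matrix.mulVec_mulVec, Wseq_iso hU t t.2, Matrix.one_mulVec]
        simp only [trial]
        ring
    · simp [hts]
  have key2 : ∀ s : Fin (2 * M),
      (∑ y : QState n, ∑ t' : Fin (2 * M), ∑ j : Fin 8,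
        (if t = cycSucc s ∧ t' = s then
          (Bmat ((-(Real.sqrt 2) : ℂ) • Wseq n M U (s : ℕ))) (x, i) (y, j) else 0)
          * trial M U Ψ (y, t', j))
      = if t = cycSucc s then -(Real.sqrt 2) * trial M U Ψ (x, t, i) else 0 := by
    intro s
    by_cases hts : t = cycSucc s
    · subst hts
      rw [if_pos rfl]
      have h := Bmat_mul (Wseq_good hU s s.2) (vst M U Ψ s) x i
      rw [← vst_cyc hU] at h
      refine Eq.trans ?_ (h.trans ?_)
      · refine Finset.sum_congr rfl fun y _ => ?_
        rw [Finset.sum_eq_single s]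
        · simp [trial]
        · intro b _ hb
          simp [hb]
        · simp
      · simp only [trial]
        ring
    · simp [hts]
  have swap : ∀ F : QState n → Fin (2 * M) → Fin 8 → Fin (2 * M) → ℂ,
      ∑ y, ∑ t', ∑ j, ∑ s, F y t' j s = ∑ s, ∑ y, ∑ t', ∑ j, F y t' j s := by
    intro F
    have e1 : ∀ y t', ∑ j, ∑ s, F y t' j s = ∑ s, ∑ j, F y t' j s :=
      fun y t' => Finset.sum_comm
    have e2 : ∀ y, ∑ t', ∑ s, ∑ j, F y t' j s = ∑ s, ∑ t', ∑ j, F y t' j s :=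
      fun y => Finset.sum_comm
    simp only [e1]
    simp only [e2]
    exact Finset.sum_comm
  rw [swap, swap]
  simp only [key1, key2]
  obtain ⟨s0, hs0⟩ := cycSucc_bij.2 t
  have h3 : ∀ s, (t = cycSucc s) = (s0 = s) := by
    intro s; rw [← hs0]; exact propext cycSucc_bij.1.eq_iff
  simp only [h3]
  simp
  ring

lemma pen_trial {n M : ℕ} (U : ℕ → Matrix (QState n) (QState n) ℂ) (Ψ : QState n → ℂ) :
    HpenC n M *ᵥ trial M U Ψ = (-1 - (Real.sqrt 2 : ℂ)) • trial M U Ψ := by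
  ext ⟨x, t, i⟩
  have h := congrFun pen_omega i
  simp only [Matrix.mulVec, dotProduct, Pi.smul_apply, smul_eq_mul] at h
  simp only [Matrix.mulVec, dotProduct, HpenC, Matrix.of_apply, Fintype.sum_prod_type,
    Pi.smul_apply, smul_eq_mul]
  rw [Finset.sum_eq_single x]
  · rw [Finset.sum_eq_single t]
    · simp only [and_self, if_true, trial]
      rw [mul_left_comm, ← h, Finset.mul_sum]
      refine Finset.sum_congr rfl fun j _ => ?_
      ring
    · intro b _ hb; simp [hb.symm]
    · simp
  · intro b _ hb; simp [hb.symm]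
  · simp

lemma in_trial {n M nin : ℕ} (U : ℕ → Matrix (QState n) (QState n) ℂ) (h : nin ≤ n)
    (ψ : QState nin → ℂ) :
    HinC n M nin *ᵥ trial M U (embedInput n nin h ψ) = 0 := by
  ext ⟨x, t, i⟩
  simp only [Matrix.mulVec, dotProduct, HinC, Matrix.of_apply, Pi.zero_apply]
  refine Finset.sum_eq_zero fun q _ => ?_
  split_ifs with hq
  · obtain ⟨rfl, h0⟩ := hq
    simp only [trial, h0, vst, embedInput]
    split_ifs with hx
    · rw [Finset.filter_false_of_mem]
      · simp
      · rintro j _ ⟨h1, h2⟩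
        rw [hx j h1] at h2
        exact absurd h2 (by decide)
    · simp
  · simp

lemma out_trial {n M : ℕ} (U : ℕ → Matrix (QState n) (QState n) ℂ) (Ψ : QState n → ℂ)
    (out : Fin n) (p : CVertex n M) :
    (HoutC n M out *ᵥ trial M U Ψ) p =
      if p.1 out = 0 ∧ (p.2.1 : ℕ) = M then trial M U Ψ p else 0 := by
  simp only [Matrix.mulVec, dotProduct, HoutC, Matrix.of_apply]
  rw [Finset.sum_eq_single p]
  · simp
  · intro b _ hb; simp [hb.symm]
  · simp

lemma embed_norm {n nin : ℕ} (h : nin ≤ n) (ψ : QState nin → ℂ) :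
    star (embedInput n nin h ψ) ⬝ᵥ embedInput n nin h ψ = star ψ ⬝ᵥ ψ := by
  simp only [dotProduct, Pi.star_apply, embedInput]
  have h1 : ∀ x : QState n,
      star ((if ∀ j : Fin n, nin ≤ (j : ℕ) → x j = 0 then (1 : ℂ) else 0)
        * ψ (fun i : Fin nin => x (Fin.castLE h i))) *
      ((if ∀ j : Fin n, nin ≤ (j : ℕ) → x j = 0 then (1 : ℂ) else 0)
        * ψ (fun i : Fin nin => x (Fin.castLE h i))) =
      if ∀ j : Fin n, nin ≤ (j : ℕ) → x j = 0 then
        star (ψ (fun i : Fin nin => x (Fin.castLE h i))) * ψ (fun i : Fin nin => x (Fin.castLE h i))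
      else 0 := by
    intro x; split_ifs <;> simp
  simp only [h1]
  rw [← Finset.sum_filter]
  refine Finset.sum_nbij' (fun x i => x (Fin.castLE h i))
    (fun y j => if hj : (j : ℕ) < nin then y ⟨j, hj⟩ else 0) ?_ ?_ ?_ ?_ ?_
  · simp
  · intro y _
    simp only [Finset.mem_filter, Finset.mem_univ, true_and]
    intro j hj
    rw [dif_neg (by omega)]
  · intro x hx
    simp only [Finset.mem_filter, Finset.mem_univ, true_and] at hx
    funext j
    by_cases hj : (j : ℕ) < nin
    · simp only [dif_pos hj]; rfl
    · simp only [dif_neg hj]; rw [hx j (by omega)]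
  · intro y _
    funext i
    simp
  · simp

lemma bdd {ι : Type*} [Fintype ι] (H : Matrix ι ι ℂ) :
    BddBelow { r : ℝ | ∃ ψ : ι → ℂ, dotProduct (star ψ) ψ = 1 ∧
      r = (dotProduct (star ψ) (H.mulVec ψ)).re } := by
  refine ⟨-∑ i, ∑ j, ‖H i j‖, ?_⟩
  rintro r ⟨ψ, h1, rfl⟩
  have hle : ∀ i, ‖ψ i‖ ≤ 1 := by
    intro i
    have h2 : ∑ i, ‖ψ i‖ ^ 2 = 1 := by
      have := congrArg Complex.re h1
      simp only [dotProduct, Pi.star_apply, Complex.re_sum, Complex.one_re] at this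
      rw [← this]
      refine Finset.sum_congr rfl fun i _ => ?_
      rw [Complex.star_def, ← Complex.normSq_eq_conj_mul_self, Complex.ofReal_re,
        Complex.normSq_eq_norm_sq]
    have h3 : ‖ψ i‖ ^ 2 ≤ 1 := by
      rw [← h2]
      exact Finset.single_le_sum (f := fun i => ‖ψ i‖ ^ 2) (fun _ _ => by positivity)
        (Finset.mem_univ i)
    nlinarith [norm_nonneg (ψ i)]
  have : ‖star ψ ⬝ᵥ (H *ᵥ ψ)‖ ≤ ∑ i, ∑ j, ‖H i j‖ := by
    simp only [dotProduct, Matrix.mulVec]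
    refine (norm_sum_le _ _).trans (Finset.sum_le_sum fun i _ => ?_)
    rw [norm_mul, Pi.star_apply, norm_star]
    refine (mul_le_of_le_one_left (norm_nonneg _) (hle i)).trans ?_
    refine (norm_sum_le _ _).trans (Finset.sum_le_sum fun j _ => ?_)
    rw [norm_mul]
    exact mul_le_of_le_one_right (norm_nonneg _) (hle j)
  have h4 := (abs_le.mp ((Complex.abs_re_le_norm _).trans this)).1
  exact h4

lemma trial_sq {n M : ℕ} (U : ℕ → Matrix (QState n) (QState n) ℂ) (Ψ : QState n → ℂ)
    (P : QState n → Fin (2 * M) → Prop) [∀ x t, Decidable (P x t)] :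
    ∑ p : CVertex n M, (if P p.1 p.2.1 then star (trial M U Ψ p) * trial M U Ψ p else 0)
      = ∑ t : Fin (2 * M), ∑ x : QState n,
        if P x t then star (vst M U Ψ t x) * vst M U Ψ t x else 0 := by
  rw [Fintype.sum_prod_type, Finset.sum_comm' (t' := Finset.univ) (s' := fun _ => Finset.univ) (by simp),
    Fintype.sum_prod_type]
  refine Finset.sum_congr rfl fun t _ => ?_
  rw [Finset.sum_comm]
  refine Finset.sum_congr rfl fun x _ => ?_
  by_cases h : P x t
  · simp only [h, if_true, trial]
    rw [← mul_one (star (vst M U Ψ t x) * vst M U Ψ t x), ← omegaVec_norm, Finset.mul_sum]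
    refine Finset.sum_congr rfl fun j _ => ?_
    rw [star_mul']
    ring
  · simp [h]

lemma trial_norm {n M : ℕ} {U : ℕ → Matrix (QState n) (QState n) ℂ}
    (hU : ∀ i, i < M → AllowedGate n (U i)) (Ψ : QState n → ℂ) (hΨ : star Ψ ⬝ᵥ Ψ = 1) :
    star (trial M U Ψ) ⬝ᵥ trial M U Ψ = 2 * M := by
  have h := trial_sq (M := M) U Ψ (fun _ _ => True)
  simp only [if_true] at h
  simp only [dotProduct, Pi.star_apply]
  rw [h]
  have : ∀ t : Fin (2 * M), ∑ x, star (vst M U Ψ t x) * vst M U Ψ t x = 1 := by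
    intro t
    have := vst_norm hU Ψ t t.2.le
    rw [hΨ] at this
    exact this
  simp only [this]
  simp

lemma trial_out {n M nin : ℕ} {U : ℕ → Matrix (QState n) (QState n) ℂ} (hM : 1 ≤ M)
    (hU : ∀ i, i < M → AllowedGate n (U i)) (h : nin ≤ n) (ψ : QState nin → ℂ)
    (hψ : star ψ ⬝ᵥ ψ = 1) (out : Fin n) :
    star (trial M U (embedInput n nin h ψ)) ⬝ᵥ
      (HoutC n M out *ᵥ trial M U (embedInput n nin h ψ))
      = ((1 - acceptProb n M nin h out U ψ : ℝ) : ℂ) := by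
  set Ψ := embedInput n nin h ψ with hΨ
  simp only [dotProduct, Pi.star_apply, out_trial, mul_ite, mul_zero]
  rw [trial_sq (M := M) U Ψ (fun x t => x out = 0 ∧ (t : ℕ) = M)]
  rw [Finset.sum_eq_single ⟨M, by omega⟩]
  · have hn := vst_norm hU Ψ M (by omega)
    rw [hΨ, embed_norm, hψ, ← hΨ] at hn
    have hc := vst_circuit U Ψ M le_rfl
    have : (acceptProb n M nin h out U ψ : ℂ) =
        ∑ x : QState n, if x out = 1 then star (vst M U Ψ M x) * vst M U Ψ M x else 0 := by
      unfold acceptProb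
      rw [← hΨ, ← hc, Complex.ofReal_sum]
      refine Finset.sum_congr rfl fun x _ => ?_
      split_ifs
      · rw [Complex.normSq_eq_conj_mul_self]; rfl
      · simp
    rw [Complex.ofReal_sub, this, Complex.ofReal_one, ← hn]
    simp only [dotProduct, Pi.star_apply, and_true]
    rw [← Finset.sum_sub_distrib]
    refine Finset.sum_congr rfl fun x _ => ?_
    have : x out = 0 ∨ x out = 1 := by
      generalize x out = a
      fin_cases a <;> simp
    rcases this with h | h <;> simp [h]
  · intro t _ ht
    refine Finset.sum_eq_zero fun x _ => if_neg ?_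
    rintro ⟨_, h2⟩
    exact ht (Fin.ext h2)
  · simp

end QC

open QC

/-- For every unit vector `ψ_in ∈ (ℂ²)^{⊗n_in}`, the smallest
eigenvalue of `A_x` is at most `e₁ + (1 − AP(ψ_in))/(2M)`, where `e₁ = −1 − 3√2` and
`AP(ψ_in) = ‖ (|1⟩⟨1|)_out · U_C (ψ_in ⊗ |0⟩^{⊗(n−n_in)}) ‖²` is the acceptance
probability of the circuit on input `ψ_in`. -/
theorem ax_yes_instance_bound
    (n M nin : ℕ) (hn : 1 ≤ n) (hM : 1 ≤ M)
    (hnin1 : 1 ≤ nin) (hninn : nin ≤ n) (out : Fin n)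
    (U : ℕ → Matrix (QState n) (QState n) ℂ)
    (hU : ∀ i, i < M → AllowedGate n (U i))
    (ψin : QState nin → ℂ)
    (hunit : dotProduct (star ψin) ψin = 1) :
    smallestEigenvalue (Ax n M nin out U)
      ≤ e1 + (1 - acceptProb n M nin hninn out U ψin) / (2 * M) := by
  have hM0 : (0 : ℝ) < 2 * M := by
    have : (1 : ℝ) ≤ M := by exact_mod_cast hM
    linarith
  set φ := trial M U (embedInput n nin hninn ψin) with hφ
  set c : ℝ := (Real.sqrt (2 * M))⁻¹ with hc
  have hcc : c * c = 1 / (2 * M) := by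
    rw [hc, ← mul_inv, Real.mul_self_sqrt hM0.le, one_div]
  have hnorm : star φ ⬝ᵥ φ = 2 * M :=
    trial_norm hU _ (by rw [embed_norm, hunit])
  have hout : star φ ⬝ᵥ (HoutC n M out *ᵥ φ)
      = ((1 - acceptProb n M nin hninn out U ψin : ℝ) : ℂ) :=
    trial_out hM hU hninn ψin hunit out
  have hA : star φ ⬝ᵥ (Ax n M nin out U *ᵥ φ)
      = ((e1 * (2 * M) + (1 - acceptProb n M nin hninn out U ψin) : ℝ) : ℂ) := by
    unfold Ax
    rw [Matrix.add_mulVec, Matrix.add_mulVec, Matrix.add_mulVec, prop_trial hU, pen_trial,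
      in_trial, add_zero, ← add_smul, dotProduct_add, dotProduct_smul, hout, ← hφ, hnorm]
    unfold e1
    push_cast
    rw [smul_eq_mul]
    ring
  have hstar : star ((c : ℂ) • φ) = (c : ℂ) • star φ := by
    rw [star_smul, Complex.star_def, Complex.conj_ofReal]
  refine csInf_le (bdd _) ⟨(c : ℂ) • φ, ?_, ?_⟩
  · rw [hstar, smul_dotProduct, dotProduct_smul, hnorm, smul_eq_mul, smul_eq_mul, ← mul_assoc,
      ← Complex.ofReal_mul, hcc]
    have : (M : ℂ) ≠ 0 := by
      exact_mod_cast (by omega : M ≠ 0)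
    push_cast
    field_simp
  · rw [hstar, Matrix.mulVec_smul, smul_dotProduct, dotProduct_smul, hA, smul_eq_mul, smul_eq_mul,
      ← mul_assoc, ← Complex.ofReal_mul, hcc, ← Complex.ofReal_mul, Complex.ofReal_re]
    field_simp
end
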